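/- arXiv:2603.23305 — 2 statements merged into one kernel-verified Lean document; each statement's English description precedes it below -/
import Mathlib

section
/- (Concentration of V*_G and V*_F.) In the Gaussian contextual graph matching model with π* = id, there is a universal constant C > 0 such that the event H1 := { for all t∈[n] and all π∈S_{n,t}: |V*_G(π) − E[V*_G(π)]| ≤ C t √(n log(en/t)) and |V*_F(π) − E[V*_F(π)]| ≤ C t √(max{d, log(en/t)} · log(en/t)) } occurs with probability at least 1 − o(1) as n → ∞. -/
open MeasureTheory ProbabilityTheory Real Filter Finset Topology

noncomputable section

namespace CGM

/-- array of (potential) edge weights of a graph on `n` vertices -/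
abbrev GW (n : ℕ) := Fin n → Fin n → ℝ

/-- array of feature values: `n` users, `d` features each -/
abbrev FW (n d : ℕ) := Fin n → Fin d → ℝ

/-- latent sample space: (graph weights, graph noise, features, feature noise) -/
abbrev Samp (n d : ℕ) := (GW n × GW n) × (FW n d × FW n d)

/-- i.i.d. standard Gaussian array (graph part) -/
def stdGaussG (n : ℕ) : Measure (GW n) :=
  Measure.pi fun _ => Measure.pi fun _ => gaussianReal 0 1

/-- i.i.d. standard Gaussian array (feature part) -/
def stdGaussF (n d : ℕ) : Measure (FW n d) :=
  Measure.pi fun _ => Measure.pi fun _ => gaussianReal 0 1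

/-- law of the latent randomness of the model -/
def μ (n d : ℕ) : Measure (Samp n d) :=
  ((stdGaussG n).prod (stdGaussG n)).prod ((stdGaussF n d).prod (stdGaussF n d))

/-- symmetrization of an array, so that only the upper-triangular part matters -/
def sym {n : ℕ} (f : GW n) : GW n := fun i j => if i ≤ j then f i j else f j i

variable {n d : ℕ}

/-- the weighted adjacency matrix `A` -/
def Amat (ω : Samp n d) : GW n := sym ω.1.1

/-- the weighted adjacency matrix `B` (before relabeling by `π*`, i.e. conditionally
on `π* = id`): each pair `(A i j, B i j)`, `i < j`, is bivariate centered Gaussian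
with unit variances and correlation `ρ`. -/
def Bmat (ρ : ℝ) (ω : Samp n d) : GW n :=
  fun i j => ρ * Amat ω i j + Real.sqrt (1 - ρ ^ 2) * sym ω.1.2 i j

/-- the feature matrix `X` -/
def Xmat (ω : Samp n d) : FW n d := ω.2.1

/-- the feature matrix `Y` (conditionally on `π* = id`): each pair `(X i j, Y i j)` is
bivariate centered Gaussian with unit variances and correlation `η`. -/
def Ymat (η : ℝ) (ω : Samp n d) : FW n d :=
  fun i j => η * ω.2.1 i j + Real.sqrt (1 - η ^ 2) * ω.2.2 i j

/-- the ordered pairs `i < j` whose unordered pair `{i,j}` is moved by `φ`;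
its cardinality is `|D^E_φ|`. -/
def movedEdges (φ : Equiv.Perm (Fin n)) : Finset (Fin n × Fin n) :=
  Finset.univ.filter fun p =>
    p.1 < p.2 ∧ ¬((φ p.1 = p.1 ∧ φ p.2 = p.2) ∨ (φ p.1 = p.2 ∧ φ p.2 = p.1))

/-- `V*_G(φ) = Σ_{{i,j} ∈ D^E_φ} B_{ij} A_{ij}` -/
def VGstar (ρ : ℝ) (φ : Equiv.Perm (Fin n)) (ω : Samp n d) : ℝ :=
  ∑ p ∈ movedEdges φ, Bmat ρ ω p.1 p.2 * Amat ω p.1 p.2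

/-- `V_G(φ) = Σ_{{i,j} ∈ D^E_φ} B_{φ(i,j)} A_{ij}` -/
def VG (ρ : ℝ) (φ : Equiv.Perm (Fin n)) (ω : Samp n d) : ℝ :=
  ∑ p ∈ movedEdges φ, Bmat ρ ω (φ p.1) (φ p.2) * Amat ω p.1 p.2

/-- `V*_F(φ) = Σ_{i ∈ D_φ, j ≤ d} Y_{ij} X_{ij}` -/
def VFstar (η : ℝ) (φ : Equiv.Perm (Fin n)) (ω : Samp n d) : ℝ :=
  ∑ i ∈ φ.support, ∑ j, Ymat η ω i j * Xmat ω i j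

/-- `V_F(φ) = Σ_{i ∈ D_φ, j ≤ d} Y_{φ(i),j} X_{ij}` -/
def VF (η : ℝ) (φ : Equiv.Perm (Fin n)) (ω : Samp n d) : ℝ :=
  ∑ i ∈ φ.support, ∑ j, Ymat η ω (φ i) j * Xmat ω i j

/-- the Hamiltonian `V(φ)` -/
def V (ρ η : ℝ) (φ : Equiv.Perm (Fin n)) (ω : Samp n d) : ℝ :=
  ρ / (1 - ρ ^ 2) * (VGstar ρ φ ω - VG ρ φ ω)
    + η / (1 - η ^ 2) * (VFstar η φ ω - VF η φ ω)

/-- the partition function `Z = Σ_φ exp(−V(φ))` -/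
def Zpart (ρ η : ℝ) (ω : Samp n d) : ℝ :=
  ∑ φ : Equiv.Perm (Fin n), Real.exp (-(V ρ η φ ω))

end CGM


namespace CGM

/-- the concentration event `H1`: for every `t ∈ [n]` and `φ ∈ S_{n,t}`
(equivalently, for every permutation `φ` with `t := |D_φ|`),
`|V*_G(φ) − E V*_G(φ)| ≤ C t √(n log(en/t))` and
`|V*_F(φ) − E V*_F(φ)| ≤ C t √(max{d, log(en/t)} log(en/t))`. -/
def H1 (C : ℝ) (n d : ℕ) (ρ η : ℝ) : Set (Samp n d) :=
  {ω | ∀ φ : Equiv.Perm (Fin n),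
    |VGstar ρ φ ω - ∫ ω', VGstar ρ φ ω' ∂μ n d| ≤
      C * φ.support.card *
        Real.sqrt (n * Real.log (Real.exp 1 * n / φ.support.card)) ∧
    |VFstar η φ ω - ∫ ω', VFstar η φ ω' ∂μ n d| ≤
      C * φ.support.card *
        Real.sqrt (max (d : ℝ) (Real.log (Real.exp 1 * n / φ.support.card)) *
          Real.log (Real.exp 1 * n / φ.support.card))}

end CGM

namespace CGM

lemma exp_le_one_add_add_sq_mul_exp_abs (x : ℝ) :
    exp x ≤ 1 + x + x ^ 2 * exp |x| := by
  have h1 : 1 ≤ exp |x| := Real.one_le_exp (abs_nonneg x)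
  rcases le_or_gt |x| 1 with h | h
  · have := (abs_le.1 (Real.abs_exp_sub_one_sub_id_le h)).2
    nlinarith [sq_nonneg x]
  · rcases lt_abs.1 h with h | h
    · rw [abs_of_pos (by linarith)] at h1 ⊢
      nlinarith [mul_le_mul_of_nonneg_right (one_le_pow₀ h.le : 1 ≤ x ^ 2) (Real.exp_pos x).le]
    · have : exp x ≤ 1 := Real.exp_le_one_iff.2 (by linarith)
      nlinarith [sq_nonneg x]

/-- A centered variable dominated by a variable `U` with `U² exp (c U)` integrable has a
sub-exponential moment generating function. -/
lemma integrable_exp_and_integral_exp_le {Ω : Type*} [MeasurableSpace Ω] {P : Measure Ω}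
    [IsProbabilityMeasure P] {Z U : Ω → ℝ} {c l : ℝ} (hl : |l| ≤ c)
    (hZ : Integrable Z P) (hZ0 : ∫ ω, Z ω ∂P = 0) (hZU : ∀ ω, |Z ω| ≤ U ω)
    (hU : Integrable (fun ω => U ω ^ 2 * exp (c * U ω)) P) :
    Integrable (fun ω => exp (l * Z ω)) P ∧
      ∫ ω, exp (l * Z ω) ∂P ≤ exp ((∫ ω, U ω ^ 2 * exp (c * U ω) ∂P) * l ^ 2) := by
  have hb : ∀ ω, exp (l * Z ω) ≤ 1 + l * Z ω + l ^ 2 * (U ω ^ 2 * exp (c * U ω)) := by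
    intro ω
    refine (exp_le_one_add_add_sq_mul_exp_abs _).trans ?_
    have h1 : exp |l * Z ω| ≤ exp (c * U ω) := by
      rw [abs_mul]
      exact Real.exp_le_exp.2 (mul_le_mul hl (hZU ω) (abs_nonneg _) ((abs_nonneg _).trans hl))
    have h2 : Z ω ^ 2 ≤ U ω ^ 2 := by
      rw [← sq_abs]
      exact pow_le_pow_left₀ (abs_nonneg _) (hZU ω) 2
    have h3 : Z ω ^ 2 * exp |l * Z ω| ≤ U ω ^ 2 * exp (c * U ω) := by gcongr
    have := mul_le_mul_of_nonneg_left h3 (sq_nonneg l)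
    rw [mul_pow]
    linarith
  have hint : Integrable (fun ω => 1 + l * Z ω + l ^ 2 * (U ω ^ 2 * exp (c * U ω))) P :=
    ((integrable_const _).add (hZ.const_mul l)).add (hU.const_mul _)
  have hexp : Integrable (fun ω => exp (l * Z ω)) P := by
    refine hint.mono' ?_ (ae_of_all _ fun ω => ?_)
    · exact (Real.continuous_exp.comp_aestronglyMeasurable (hZ.const_mul l).aestronglyMeasurable)
    · rw [Real.norm_eq_abs, abs_of_pos (Real.exp_pos _)]
      exact hb ω
  refine ⟨hexp, (integral_mono hexp hint hb).trans ?_⟩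
  rw [integral_add (by fun_prop) (hU.const_mul _),
    integral_add (integrable_const _) (hZ.const_mul l), integral_const_mul, integral_const_mul, hZ0]
  simp only [integral_const, probReal_univ, smul_eq_mul, mul_one, mul_zero, add_zero]
  have := Real.add_one_le_exp ((∫ ω, U ω ^ 2 * exp (c * U ω) ∂P) * l ^ 2)
  linarith

/-- law of a pair of independent standard Gaussians -/
def stdPair : Measure (ℝ × ℝ) := (gaussianReal 0 1).prod (gaussianReal 0 1)

instance : IsProbabilityMeasure stdPair := by unfold stdPair; infer_instance

/-- product of two standard Gaussians with correlation `r`, as a function of independent ones -/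
def corrMul (r : ℝ) (z : ℝ × ℝ) : ℝ := (r * z.1 + √(1 - r ^ 2) * z.2) * z.1

lemma measurable_corrMul (r : ℝ) : Measurable (corrMul r) := by
  unfold corrMul; fun_prop

lemma corrMul_eq (r : ℝ) :
    corrMul r = fun z => r * (z.1 ^ 2 * 1) + √(1 - r ^ 2) * (z.1 * z.2) := by
  ext z; simp only [corrMul]; ring

lemma integrable_sq_gaussianReal : Integrable (fun x : ℝ => x ^ 2) (gaussianReal 0 1) :=
  (memLp_id_gaussianReal 2).integrable_sq

lemma integrable_id_gaussianReal : Integrable (fun x : ℝ => x) (gaussianReal 0 1) :=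
  (memLp_id_gaussianReal 1).integrable le_rfl

lemma integral_sq_gaussianReal : ∫ x : ℝ, x ^ 2 ∂gaussianReal 0 1 = 1 := by
  have h := variance_fun_id_gaussianReal (μ := 0) (v := 1)
  rw [variance_of_integral_eq_zero measurable_id'.aemeasurable (by simp)] at h
  simpa using h

lemma integrable_corrMul (r : ℝ) : Integrable (corrMul r) stdPair := by
  rw [corrMul_eq]
  exact ((integrable_sq_gaussianReal.mul_prod (integrable_const 1)).const_mul _).add
    ((integrable_id_gaussianReal.mul_prod integrable_id_gaussianReal).const_mul _)

lemma integral_corrMul (r : ℝ) : ∫ z, corrMul r z ∂stdPair = r := by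
  rw [corrMul_eq, stdPair, integral_add, integral_const_mul, integral_const_mul,
    integral_prod_mul (fun x : ℝ => x ^ 2) (fun _ => (1 : ℝ)),
    integral_prod_mul (fun x : ℝ => x) (fun x => x), integral_sq_gaussianReal]
  · simp
  · exact (integrable_sq_gaussianReal.mul_prod (integrable_const 1)).const_mul _
  · exact (integrable_id_gaussianReal.mul_prod integrable_id_gaussianReal).const_mul _

lemma abs_corrMul_sub_le {r : ℝ} (hr : r ∈ Set.Icc (-1 : ℝ) 1) (z : ℝ × ℝ) :
    |corrMul r z - r| ≤ 1 + 2 * (z.1 ^ 2 + z.2 ^ 2) := by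
  have hr' : |r| ≤ 1 := abs_le.2 hr
  have hs : √(1 - r ^ 2) ≤ 1 := Real.sqrt_le_one.2 (by nlinarith [sq_nonneg r])
  have h1 : |r * z.1 ^ 2| ≤ z.1 ^ 2 := by
    rw [abs_mul, abs_of_nonneg (sq_nonneg z.1)]
    exact mul_le_of_le_one_left (sq_nonneg _) hr'
  have h2 : |√(1 - r ^ 2) * (z.1 * z.2)| ≤ |z.1 * z.2| := by
    rw [abs_mul, abs_of_nonneg (Real.sqrt_nonneg _)]
    exact mul_le_of_le_one_left (abs_nonneg _) hs
  have h3 : |z.1 * z.2| ≤ z.1 ^ 2 + z.2 ^ 2 := by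
    rw [abs_le]
    constructor <;> nlinarith [sq_nonneg (z.1 + z.2), sq_nonneg (z.1 - z.2)]
  have h4 : corrMul r z - r = r * z.1 ^ 2 + √(1 - r ^ 2) * (z.1 * z.2) - r := by
    simp only [corrMul]; ring
  rw [h4]
  calc _ ≤ |r * z.1 ^ 2| + |√(1 - r ^ 2) * (z.1 * z.2)| + |r| :=
        (abs_sub _ _).trans (by gcongr; exact abs_add_le _ _)
    _ ≤ _ := by nlinarith [sq_nonneg z.1, sq_nonneg z.2]

lemma exists_mgf_corrMul_le : ∃ c > (0 : ℝ), ∃ K ≥ (0 : ℝ), ∀ r ∈ Set.Icc (-1 : ℝ) 1,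
    ∀ l : ℝ, |l| ≤ c → Integrable (fun z => exp (l * (corrMul r z - r))) stdPair ∧
      ∫ z, exp (l * (corrMul r z - r)) ∂stdPair ≤ exp (K * l ^ 2) := by
  obtain ⟨a, ha, hint⟩ := IsGaussian.exists_integrable_exp_sq (gaussianReal 0 1)
  set c := a / 6 with hc
  have hc0 : 0 < c := by positivity
  let U : ℝ × ℝ → ℝ := fun z => 1 + 2 * (z.1 ^ 2 + z.2 ^ 2)
  have hU : Integrable (fun z => U z ^ 2 * exp (c * U z)) stdPair := by
    have h := (hint.mul_prod hint).const_mul ((c ^ 2)⁻¹ * exp (3 * c))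
    refine h.mono' (by fun_prop) (ae_of_all _ fun z => ?_)
    have hU0 : 0 ≤ U z := by positivity
    have h1 : c * U z ≤ exp (c * U z) := by linarith [Real.add_one_le_exp (c * U z)]
    have h2 : U z ^ 2 ≤ (c ^ 2)⁻¹ * exp (c * U z) ^ 2 := by
      rw [inv_mul_eq_div, le_div_iff₀ (by positivity), mul_comm, ← mul_pow]
      gcongr
    rw [Real.norm_eq_abs, abs_of_nonneg (by positivity)]
    calc U z ^ 2 * exp (c * U z) ≤ (c ^ 2)⁻¹ * exp (c * U z) ^ 2 * exp (c * U z) := by gcongr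
      _ = _ := by
        rw [mul_assoc, mul_assoc, ← pow_succ, ← Real.exp_nat_mul, ← Real.exp_add, ← Real.exp_add]
        congr 2
        simp only [U, Real.norm_eq_abs, sq_abs, hc]
        push_cast
        ring
  refine ⟨c, hc0, _, integral_nonneg fun z => ?_, fun r hr l hl =>
    integrable_exp_and_integral_exp_le hl ((integrable_corrMul r).sub (integrable_const r)) ?_
      (abs_corrMul_sub_le hr) hU⟩
  · positivity
  · rw [integral_sub (integrable_corrMul r) (integrable_const r), integral_corrMul]
    simp

section Arrays

variable {ι κ Ω : Type*} [Fintype ι] [Fintype κ] [MeasurableSpace Ω] {P : Measure Ω}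
  {Φ : Ω → ι → κ → ℝ × ℝ}

/-- law of an array of i.i.d. pairs of independent standard Gaussians -/
def stdPairs (ι κ : Type*) [Fintype ι] [Fintype κ] : Measure (ι → κ → ℝ × ℝ) :=
  Measure.pi fun _ => Measure.pi fun _ => stdPair

/-- Moment generating function of a partial sum of an i.i.d. array. -/
lemma integrable_and_integral_exp_sum_le {h : ℝ × ℝ → ℝ} {l b : ℝ}
    (hi : Integrable (fun z => exp (l * h z)) stdPair)
    (hb : ∫ z, exp (l * h z) ∂stdPair ≤ exp b) (S : Finset (ι × κ)) :
    Integrable (fun z => exp (l * ∑ p ∈ S, h (z p.1 p.2))) (stdPairs ι κ) ∧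
      ∫ z, exp (l * ∑ p ∈ S, h (z p.1 p.2)) ∂stdPairs ι κ ≤ exp (b * #S) := by
  classical
  let f : ι → κ → ℝ × ℝ → ℝ := fun i j z => if (i, j) ∈ S then exp (l * h z) else 1
  have hf : ∀ i j, Integrable (f i j) stdPair := by
    intro i j
    by_cases hS : (i, j) ∈ S
    · simpa only [f, hS, if_true] using hi
    · simp only [f, hS, if_false]; exact integrable_const 1
  have hprod : (fun z : ι → κ → ℝ × ℝ => exp (l * ∑ p ∈ S, h (z p.1 p.2))) =
      fun z => ∏ i, (fun y : κ → ℝ × ℝ => ∏ j, f i j (y j)) (z i) := by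
    ext z
    simp only [f]
    rw [Finset.mul_sum, Real.exp_sum, ← Fintype.prod_prod_type'
      (f := fun i j => if (i, j) ∈ S then exp (l * h (z i j)) else 1),
      ← Finset.prod_filter]
    simp
  rw [hprod]
  constructor
  · exact Integrable.fintype_prod fun i => Integrable.fintype_prod (hf i)
  · unfold stdPairs
    rw [integral_fintype_prod_eq_prod (f := fun i (y : κ → ℝ × ℝ) => ∏ j, f i j (y j))]
    simp_rw [integral_fintype_prod_eq_prod]
    rw [← Fintype.prod_prod_type' (f := fun i j => ∫ z, f i j z ∂stdPair)]
    have : ∀ p : ι × κ, ∫ z, f p.1 p.2 z ∂stdPair ≤ if p ∈ S then exp b else 1 := by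
      intro p
      by_cases hS : p ∈ S
      · simpa [f, hS] using hb
      · simp [f, hS]
    refine (Finset.prod_le_prod (fun p _ => integral_nonneg fun z => ?_)
      fun p _ => this p).trans ?_
    · simp only [f]; split_ifs <;> positivity
    · rw [← Finset.prod_filter]
      simp [mul_comm b, Real.exp_nat_mul]

lemma integral_sum_corrMul (hΦ : MeasurePreserving Φ P (stdPairs ι κ)) (r : ℝ)
    (S : Finset (ι × κ)) :
    ∫ ω, ∑ p ∈ S, corrMul r (Φ ω p.1 p.2) ∂P = ∑ _p ∈ S, r := by
  have hp : ∀ p : ι × κ, MeasurePreserving (fun ω => Φ ω p.1 p.2) P stdPair := fun p =>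
    ((measurePreserving_eval (fun _ : κ => stdPair) p.2).comp
      (measurePreserving_eval (fun _ : ι => Measure.pi fun _ : κ => stdPair) p.1)).comp hΦ
  have hi : ∀ p ∈ S, Integrable (fun ω => corrMul r (Φ ω p.1 p.2)) P := fun p _ =>
    (hp p).integrable_comp_of_integrable (integrable_corrMul r)
  rw [integral_finsetSum _ hi]
  refine Finset.sum_congr rfl fun p _ => ?_
  rw [← integral_map (hp p).measurable.aemeasurable
    (measurable_corrMul r).aestronglyMeasurable, (hp p).map_eq, integral_corrMul]

/-- Chernoff bound for the centered partial sums. -/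
lemma measure_le_abs_sum_le [IsProbabilityMeasure P] (hΦ : MeasurePreserving Φ P (stdPairs ι κ))
    {c K : ℝ} {r : ℝ}
    (hmgf : ∀ l : ℝ, |l| ≤ c → Integrable (fun z => exp (l * (corrMul r z - r))) stdPair ∧
      ∫ z, exp (l * (corrMul r z - r)) ∂stdPair ≤ exp (K * l ^ 2))
    (S : Finset (ι × κ)) (x : ℝ) {l : ℝ} (hl0 : 0 ≤ l) (hl : l ≤ c) :
    P.real {ω | x ≤ |∑ p ∈ S, (corrMul r (Φ ω p.1 p.2) - r)|} ≤
      2 * exp (-l * x + K * l ^ 2 * #S) := by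
  let W : (ι → κ → ℝ × ℝ) → ℝ := fun z => ∑ p ∈ S, (corrMul r (z p.1 p.2) - r)
  have hW : Measurable W := by
    have := measurable_corrMul r
    fun_prop
  have key : ∀ s : ℝ, |s| ≤ c → Integrable (fun ω => exp (s * W (Φ ω))) P ∧
      mgf (fun ω => W (Φ ω)) P s ≤ exp (K * s ^ 2 * #S) := by
    intro s hs
    obtain ⟨h1, h2⟩ := integrable_and_integral_exp_sum_le (hmgf s hs).1 (hmgf s hs).2 S
    refine ⟨hΦ.integrable_comp_of_integrable h1, ?_⟩
    rw [← hΦ.map_eq, integral_map hΦ.measurable.aemeasurable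
      (hW.const_mul s).exp.aestronglyMeasurable] at h2
    exact h2
  obtain ⟨hp1, hp2⟩ := key l (by rwa [abs_of_nonneg hl0])
  obtain ⟨hn1, hn2⟩ := key (-l) (by rwa [abs_neg, abs_of_nonneg hl0])
  have h1 := measure_ge_le_exp_mul_mgf (μ := P) x hl0 hp1
  have h2 := measure_le_le_exp_mul_mgf (μ := P) (-x) (neg_nonpos.2 hl0) hn1
  rw [neg_sq] at hn2
  calc P.real {ω | x ≤ |W (Φ ω)|}
      ≤ P.real ({ω | x ≤ W (Φ ω)} ∪ {ω | W (Φ ω) ≤ -x}) := by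
        refine measureReal_mono fun ω hω => ?_
        rcases le_abs.1 (show x ≤ |W (Φ ω)| from hω) with h | h
        · exact Or.inl h
        · exact Or.inr (show W (Φ ω) ≤ -x by linarith)
    _ ≤ _ := measureReal_union_le _ _
    _ ≤ exp (-l * x) * exp (K * l ^ 2 * #S) + exp (-l * x) * exp (K * l ^ 2 * #S) := by
        refine add_le_add (h1.trans (by gcongr)) (h2.trans ?_)
        rw [show - -l * -x = -l * x by ring]
        gcongr
    _ = _ := by rw [← Real.exp_add]; ring

/-- Chernoff bound at the scale used in the union bound over supports of size `t`. -/
lemma measure_le_abs_sum_le_exp_neg [IsProbabilityMeasure P]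
    (hΦ : MeasurePreserving Φ P (stdPairs ι κ)) {c K : ℝ} {r : ℝ} (hc : 0 < c) (hK : 0 ≤ K)
    (hmgf : ∀ l : ℝ, |l| ≤ c → Integrable (fun z => exp (l * (corrMul r z - r))) stdPair ∧
      ∫ z, exp (l * (corrMul r z - r)) ∂stdPair ≤ exp (K * l ^ 2))
    (S : Finset (ι × κ)) {t L M C : ℝ} (ht : 0 ≤ t) (hL : 0 < L) (hLM : L ≤ M)
    (hS : #S ≤ 2 * t * M) (hC : 3 + 2 * K * c ^ 2 ≤ c * C) :
    P.real {ω | C * t * √(M * L) ≤ |∑ p ∈ S, (corrMul r (Φ ω p.1 p.2) - r)|} ≤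
      2 * exp (-3 * (t * L)) := by
  have hM : 0 < M := hL.trans_le hLM
  have hq : √(L / M) ≤ 1 := Real.sqrt_le_one.2 ((div_le_one hM).2 hLM)
  refine (measure_le_abs_sum_le hΦ hmgf S _ (l := c * √(L / M)) (by positivity)
    (mul_le_of_le_one_right hc.le hq)).trans ?_
  gcongr
  have h1 : √(L / M) * √(M * L) = L := by
    rw [← Real.sqrt_mul (by positivity), show L / M * (M * L) = L ^ 2 by field_simp,
      Real.sqrt_sq hL.le]
  have h2 : K * (c * √(L / M)) ^ 2 * #S ≤ 2 * K * c ^ 2 * (t * L) := by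
    rw [mul_pow, Real.sq_sqrt (by positivity)]
    calc K * (c ^ 2 * (L / M)) * #S ≤ K * (c ^ 2 * (L / M)) * (2 * t * M) := by gcongr
      _ = _ := by field_simp
  have h3 : -(c * √(L / M)) * (C * t * √(M * L)) = -(c * C) * (t * L) := by
    linear_combination (-c * C * t) * h1
  rw [h3]
  nlinarith [mul_nonneg ht hL.le]

end Arrays

end CGM

namespace CGM

/-- the array of pairs obtained from a pair of arrays -/
def zipArr {ι κ : Type*} (f : (ι → κ → ℝ) × (ι → κ → ℝ)) (i : ι) (j : κ) : ℝ × ℝ :=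
  (f.1 i j, f.2 i j)

lemma measurePreserving_zipArr (ι κ : Type*) [Fintype ι] [Fintype κ] :
    MeasurePreserving (zipArr (ι := ι) (κ := κ))
      ((Measure.pi fun _ => Measure.pi fun _ => gaussianReal 0 1).prod
        (Measure.pi fun _ => Measure.pi fun _ => gaussianReal 0 1))
      (stdPairs ι κ) := by
  have h1 := (measurePreserving_arrowProdEquivProdArrow (κ → ℝ) (κ → ℝ) ι
    (fun _ => Measure.pi fun _ => gaussianReal 0 1)
    (fun _ => Measure.pi fun _ => gaussianReal 0 1)).symm
  have h2 := (measurePreserving_arrowProdEquivProdArrow ℝ ℝ κ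
    (fun _ => gaussianReal 0 1) (fun _ => gaussianReal 0 1)).symm
  exact (measurePreserving_pi _ (fun _ : ι => Measure.pi fun _ : κ => stdPair)
    fun _ => h2).comp h1

variable {n d : ℕ}

instance : IsProbabilityMeasure (stdGaussG n) := by unfold stdGaussG; infer_instance

instance : IsProbabilityMeasure (stdGaussF n d) := by unfold stdGaussF; infer_instance

instance : IsProbabilityMeasure (μ n d) := by unfold μ; infer_instance

lemma measurePreserving_graphPairs :
    MeasurePreserving (fun ω : Samp n d => zipArr ω.1) (μ n d) (stdPairs (Fin n) (Fin n)) :=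
  (measurePreserving_zipArr (Fin n) (Fin n)).comp measurePreserving_fst

lemma measurePreserving_featurePairs :
    MeasurePreserving (fun ω : Samp n d => zipArr ω.2) (μ n d) (stdPairs (Fin n) (Fin d)) :=
  (measurePreserving_zipArr (Fin n) (Fin d)).comp measurePreserving_snd

lemma VGstar_eq_sum (ρ : ℝ) (φ : Equiv.Perm (Fin n)) (ω : Samp n d) :
    VGstar ρ φ ω = ∑ p ∈ movedEdges φ, corrMul ρ (zipArr ω.1 p.1 p.2) := by
  refine Finset.sum_congr rfl fun p hp => ?_
  have hp' : p.1 ≤ p.2 := (Finset.mem_filter.1 hp).2.1.le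
  simp [Bmat, Amat, sym, hp', corrMul, zipArr]

lemma VFstar_eq_sum (η : ℝ) (φ : Equiv.Perm (Fin n)) (ω : Samp n d) :
    VFstar η φ ω = ∑ p ∈ φ.support ×ˢ univ, corrMul η (zipArr ω.2 p.1 p.2) := by
  rw [Finset.sum_product]
  rfl

lemma VGstar_sub_integral (ρ : ℝ) (φ : Equiv.Perm (Fin n)) (ω : Samp n d) :
    VGstar ρ φ ω - ∫ ω', VGstar ρ φ ω' ∂μ n d =
      ∑ p ∈ movedEdges φ, (corrMul ρ (zipArr ω.1 p.1 p.2) - ρ) := by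
  simp_rw [VGstar_eq_sum]
  rw [integral_sum_corrMul measurePreserving_graphPairs, Finset.sum_sub_distrib]

lemma VFstar_sub_integral (η : ℝ) (φ : Equiv.Perm (Fin n)) (ω : Samp n d) :
    VFstar η φ ω - ∫ ω', VFstar η φ ω' ∂μ n d =
      ∑ p ∈ φ.support ×ˢ univ, (corrMul η (zipArr ω.2 p.1 p.2) - η) := by
  simp_rw [VFstar_eq_sum]
  rw [integral_sum_corrMul measurePreserving_featurePairs, Finset.sum_sub_distrib]

/-- ordered edges with at least one endpoint in `T` -/
def touchingEdges (T : Finset (Fin n)) : Finset (Fin n × Fin n) :=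
  univ.filter fun p => p.1 < p.2 ∧ (p.1 ∈ T ∨ p.2 ∈ T)

/-- ordered edges whose endpoints are exchanged by `φ` -/
def swappedEdges (φ : Equiv.Perm (Fin n)) : Finset (Fin n × Fin n) :=
  univ.filter fun p => p.1 < p.2 ∧ φ p.1 = p.2 ∧ φ p.2 = p.1

lemma card_touchingEdges_le (T : Finset (Fin n)) : #(touchingEdges T) ≤ 2 * #T * n := by
  have h : touchingEdges T ⊆ T ×ˢ univ ∪ univ ×ˢ T := by
    intro p hp
    have := (Finset.mem_filter.1 hp).2.2
    simpa using this
  refine (Finset.card_le_card h).trans ((Finset.card_union_le _ _).trans ?_)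
  simp only [Finset.card_product, Finset.card_univ, Fintype.card_fin]
  apply le_of_eq
  ring

lemma card_swappedEdges_le (φ : Equiv.Perm (Fin n)) : #(swappedEdges φ) ≤ #φ.support := by
  refine Finset.card_le_card_of_injOn Prod.fst (fun p hp => ?_) fun p hp q hq h => ?_
  · obtain ⟨-, h1, h2, -⟩ := Finset.mem_filter.1 hp
    simpa [h2] using h1.ne'
  · obtain ⟨-, -, h1, -⟩ := Finset.mem_filter.1 hp
    obtain ⟨-, -, h2, -⟩ := Finset.mem_filter.1 hq
    exact Prod.ext h (by rw [← h1, ← h2, h])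

lemma sum_movedEdges (φ : Equiv.Perm (Fin n)) (f : Fin n × Fin n → ℝ) :
    ∑ p ∈ movedEdges φ, f p =
      ∑ p ∈ touchingEdges φ.support, f p - ∑ p ∈ swappedEdges φ, f p := by
  have hsub : swappedEdges φ ⊆ touchingEdges φ.support := by
    intro p hp
    obtain ⟨-, h1, h2, h3⟩ := Finset.mem_filter.1 hp
    refine Finset.mem_filter.2 ⟨mem_univ _, h1, Or.inl ?_⟩
    simpa [h2] using h1.ne'
  have : movedEdges φ = touchingEdges φ.support \ swappedEdges φ := by
    ext p
    simp only [movedEdges, touchingEdges, swappedEdges, mem_filter, mem_univ, true_and, Finset.mem_sdiff,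
      Equiv.Perm.mem_support]
    tauto
  rw [this, ← Finset.sum_sdiff hsub]
  ring

/-- If no partial sum over the edges touching a support, over the features of a support, or at a
single edge is large, then the concentration event holds. -/
lemma mem_H1_of_forall_lt {C ρ η : ℝ} (hC : 0 ≤ C) (ω : Samp n d)
    (hG : ∀ T : Finset (Fin n), T.Nonempty →
      |∑ p ∈ touchingEdges T, (corrMul ρ (zipArr ω.1 p.1 p.2) - ρ)| ≤
        C * #T * √(n * log (exp 1 * n / #T)))
    (hE : ∀ p : Fin n × Fin n, |corrMul ρ (zipArr ω.1 p.1 p.2) - ρ| ≤ C * √n)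
    (hF : ∀ T : Finset (Fin n), T.Nonempty →
      |∑ p ∈ T ×ˢ univ, (corrMul η (zipArr ω.2 p.1 p.2) - η)| ≤
        C * #T * √(max (d : ℝ) (log (exp 1 * n / #T)) * log (exp 1 * n / #T)))
    (hL : ∀ T : Finset (Fin n), T.Nonempty → 1 ≤ log (exp 1 * n / #T)) :
    ω ∈ H1 (2 * C) n d ρ η := by
  intro φ
  rw [VGstar_sub_integral, VFstar_sub_integral]
  rcases φ.support.eq_empty_or_nonempty with h | h
  · have : φ = 1 := Equiv.Perm.support_eq_empty_iff.1 h
    subst this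
    simp [movedEdges]
  constructor
  · rw [sum_movedEdges]
    have h1 : |∑ p ∈ swappedEdges φ, (corrMul ρ (zipArr ω.1 p.1 p.2) - ρ)| ≤
        C * #φ.support * √(n * log (exp 1 * n / #φ.support)) := by
      calc _ ≤ ∑ p ∈ swappedEdges φ, |corrMul ρ (zipArr ω.1 p.1 p.2) - ρ| :=
            Finset.abs_sum_le_sum_abs _ _
        _ ≤ ∑ p ∈ swappedEdges φ, C * √n := Finset.sum_le_sum fun p _ => hE p
        _ = C * #(swappedEdges φ) * √n := by
            rw [Finset.sum_const, nsmul_eq_mul]; ring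
        _ ≤ _ := by
            gcongr
            · exact card_swappedEdges_le φ
            · exact le_mul_of_one_le_right (Nat.cast_nonneg _) (hL _ h)
    refine (abs_sub _ _).trans ?_
    linarith [hG _ h]
  · have h0 := hF _ h
    refine h0.trans ?_
    gcongr
    linarith

lemma one_le_log_exp_one_mul_div {t : ℕ} (ht : 0 < t) (htn : t ≤ n) :
    1 ≤ log (exp 1 * n / t) := by
  have ht' : (0 : ℝ) < t := by exact_mod_cast ht
  have htn' : (t : ℝ) ≤ n := by exact_mod_cast htn
  have hn' : (0 : ℝ) < n := ht'.trans_le htn'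
  rw [Real.le_log_iff_exp_le (by positivity), le_div_iff₀ ht']
  gcongr

lemma log_exp_one_mul_div {t : ℕ} (ht : 0 < t) (htn : t ≤ n) :
    log (exp 1 * n / t) = 1 + log n - log t := by
  have ht' : (0 : ℝ) < t := by exact_mod_cast ht
  have hn' : (0 : ℝ) < n := by exact_mod_cast ht.trans_le htn
  rw [Real.log_div (by positivity) ht'.ne', Real.log_mul (by positivity) hn'.ne', Real.log_exp]

lemma log_exp_one_mul_div_le {t : ℕ} (ht : 0 < t) (htn : t ≤ n) :
    log (exp 1 * n / t) ≤ n := by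
  have hn' : (0 : ℝ) < n := by exact_mod_cast ht.trans_le htn
  rw [log_exp_one_mul_div ht htn]
  have h1 : 0 ≤ log (t : ℝ) := Real.log_natCast_nonneg t
  have h2 := Real.log_le_sub_one_of_pos hn'
  linarith

lemma log_le_mul_log {t : ℕ} (ht : 0 < t) (htn : t ≤ n) :
    log n ≤ t * log (exp 1 * n / t) := by
  have ht' : (1 : ℝ) ≤ t := by exact_mod_cast ht
  rw [log_exp_one_mul_div ht htn]
  have h1 : log (t : ℝ) ≤ t - 1 := Real.log_le_sub_one_of_pos (by linarith)
  have h2 : log (t : ℝ) ≤ log n := Real.log_le_log (by linarith) (by exact_mod_cast htn)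
  nlinarith [mul_le_mul_of_nonneg_left h2 (sub_nonneg.2 ht')]

lemma choose_le_exp_mul_log {t : ℕ} (ht : 0 < t) (htn : t ≤ n) :
    (n.choose t : ℝ) ≤ exp (t * log (exp 1 * n / t)) := by
  have ht' : (0 : ℝ) < t := by exact_mod_cast ht
  have hn' : (0 : ℝ) < n := by exact_mod_cast ht.trans_le htn
  rw [Real.exp_nat_mul, Real.exp_log (by positivity)]
  refine (Nat.choose_le_pow_div t n).trans ?_
  have h := Real.pow_div_factorial_le_exp (t : ℝ) ht'.le t
  rw [div_pow, mul_pow, ← Real.exp_nat_mul, mul_one, le_div_iff₀ (by positivity)]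
  calc (n : ℝ) ^ t / t.factorial * (t : ℝ) ^ t = (t : ℝ) ^ t / t.factorial * (n : ℝ) ^ t := by ring
    _ ≤ _ := by gcongr

lemma sum_exp_neg_le (hn : 0 < n) :
    ∑ T ∈ (univ : Finset (Finset (Fin n))).filter (·.Nonempty),
      exp (-3 * (#T * log (exp 1 * n / #T))) ≤ 1 / n := by
  have hn' : (0 : ℝ) < n := by exact_mod_cast hn
  let g : ℕ → ℝ := fun t => if t = 0 then 0 else exp (-3 * (t * log (exp 1 * n / t)))
  calc _ = ∑ T ∈ (univ : Finset (Fin n)).powerset, g #T := by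
        rw [Finset.sum_filter, Finset.powerset_univ]
        refine Finset.sum_congr rfl fun T _ => ?_
        by_cases hT : T = ∅
        · simp [g, hT]
        · simp [g, hT, Finset.nonempty_iff_ne_empty]
    _ = ∑ t ∈ range (n + 1), n.choose t * g t := by
        rw [Finset.sum_powerset_apply_card]; simp
    _ = ∑ t ∈ range n, n.choose (t + 1) * g (t + 1) := by
        rw [Finset.sum_range_succ']; simp [g]
    _ ≤ ∑ _t ∈ range n, ((n : ℝ) ^ 2)⁻¹ := by
        refine Finset.sum_le_sum fun t ht => ?_
        have htn : t + 1 ≤ n := by have := Finset.mem_range.1 ht; omega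
        have h1 := choose_le_exp_mul_log t.succ_pos htn
        have h2 := log_le_mul_log t.succ_pos htn
        simp only [g, Nat.succ_ne_zero, if_false]
        set y : ℝ := (t + 1 : ℕ) * log (exp 1 * n / (t + 1 : ℕ))
        calc (n.choose (t + 1) : ℝ) * exp (-3 * y) ≤ exp y * exp (-3 * y) := by gcongr
          _ = exp (-(2 : ℕ) * y) := by rw [← Real.exp_add]; push_cast; ring_nf
          _ ≤ exp (-(2 : ℕ) * log n) := by
              apply Real.exp_le_exp.2; push_cast; linarith
          _ = _ := by rw [neg_mul, Real.exp_neg, Real.exp_nat_mul, Real.exp_log hn']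
    _ = 1 / n := by
        rw [Finset.sum_const, Finset.card_range, nsmul_eq_mul]; field_simp

lemma sq_mul_exp_neg_sqrt_le (hn : 0 < n) : (n : ℝ) ^ 2 * exp (-3 * √n) ≤ 1 / n := by
  have hn' : (0 : ℝ) < n := by exact_mod_cast hn
  have h := Real.pow_div_factorial_le_exp (3 * √n) (by positivity) 6
  have h6 : (√n : ℝ) ^ 6 = (n : ℝ) ^ 3 := by
    rw [show 6 = 2 * 3 by norm_num, pow_mul, Real.sq_sqrt hn'.le]
  rw [mul_pow, h6] at h
  have h' : (n : ℝ) ^ 3 ≤ exp (3 * √n) := by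
    refine le_trans ?_ h
    have : (0 : ℝ) < (n : ℝ) ^ 3 := by positivity
    norm_num [Nat.factorial]
    linarith
  rw [neg_mul, Real.exp_neg, ← div_eq_mul_inv, div_le_div_iff₀ (Real.exp_pos _) hn']
  linarith [pow_succ (n : ℝ) 2]

lemma exists_measure_compl_H1_le : ∃ C > (0 : ℝ), ∀ n d : ℕ, 0 < n →
    ∀ ρ ∈ Set.Icc (-1 : ℝ) 1, ∀ η ∈ Set.Icc (-1 : ℝ) 1,
      (μ n d).real (H1 C n d ρ η)ᶜ ≤ 6 / n := by
  obtain ⟨c, hc, K, hK, hmgf⟩ := exists_mgf_corrMul_le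
  let C := (3 + 2 * K * c ^ 2) / c
  have hC0 : 0 < C := by positivity
  have hC : 3 + 2 * K * c ^ 2 ≤ c * C := by simp only [C]; field_simp; rfl
  refine ⟨2 * C, by positivity, fun n d hn ρ hρ η hη => ?_⟩
  have hn1 : (1 : ℝ) ≤ n := by exact_mod_cast hn
  let L : Finset (Fin n) → ℝ := fun T => log (exp 1 * n / #T)
  let G : Finset (Fin n) → Set (Samp n d) := fun T =>
    {ω | C * #T * √(n * L T) ≤ |∑ p ∈ touchingEdges T, (corrMul ρ (zipArr ω.1 p.1 p.2) - ρ)|}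
  let F : Finset (Fin n) → Set (Samp n d) := fun T =>
    {ω | C * #T * √(max (d : ℝ) (L T) * L T) ≤
      |∑ p ∈ T ×ˢ univ, (corrMul η (zipArr ω.2 p.1 p.2) - η)|}
  let E : Fin n × Fin n → Set (Samp n d) := fun p =>
    {ω | C * (1 : ℝ) * √(√n * √n) ≤ |∑ q ∈ {p}, (corrMul ρ (zipArr ω.1 q.1 q.2) - ρ)|}
  have hcard : ∀ T : Finset (Fin n), #T ≤ n := fun T => by simpa using Finset.card_le_univ T
  have hL : ∀ T : Finset (Fin n), T.Nonempty → 1 ≤ L T := fun T hT =>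
    one_le_log_exp_one_mul_div hT.card_pos (hcard T)
  have hG : ∀ T : Finset (Fin n), T.Nonempty → (μ n d).real (G T) ≤ 2 * exp (-3 * (#T * L T)) :=
    fun T hT => measure_le_abs_sum_le_exp_neg measurePreserving_graphPairs hc hK (hmgf ρ hρ)
      (touchingEdges T) (Nat.cast_nonneg _) (zero_lt_one.trans_le (hL T hT))
      (log_exp_one_mul_div_le hT.card_pos (hcard T))
      (by exact_mod_cast card_touchingEdges_le T) hC
  have hF : ∀ T : Finset (Fin n), T.Nonempty → (μ n d).real (F T) ≤ 2 * exp (-3 * (#T * L T)) :=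
    fun T hT => measure_le_abs_sum_le_exp_neg measurePreserving_featurePairs hc hK (hmgf η hη)
      (T ×ˢ univ) (Nat.cast_nonneg _) (zero_lt_one.trans_le (hL T hT)) (le_max_right _ _)
      (by
        rw [Finset.card_product, Finset.card_univ, Fintype.card_fin, Nat.cast_mul]
        have : (0 : ℝ) ≤ #T * (d : ℝ) := by positivity
        calc (#T : ℝ) * d ≤ 2 * #T * d := by linarith
          _ ≤ _ := by gcongr; exact le_max_left _ _) hC
  have hs : (1 : ℝ) ≤ √n := Real.one_le_sqrt.2 hn1
  have hE : ∀ p, (μ n d).real (E p) ≤ 2 * exp (-3 * √n) := fun p => by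
    have := measure_le_abs_sum_le_exp_neg measurePreserving_graphPairs hc hK (hmgf ρ hρ)
      {p} (P := μ n d) zero_le_one (zero_lt_one.trans_le hs) le_rfl
      (by rw [Finset.card_singleton]; push_cast; linarith) hC
    rwa [one_mul] at this
  have hsub : (H1 (2 * C) n d ρ η)ᶜ ⊆
      (⋃ T ∈ (univ : Finset (Finset (Fin n))).filter (·.Nonempty), (G T ∪ F T)) ∪
        ⋃ p ∈ (univ : Finset (Fin n × Fin n)), E p := by
    intro ω hω
    by_contra hcon
    simp only [Set.mem_union, Set.mem_iUnion, mem_filter, mem_univ, true_and, exists_prop, not_or,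
      not_exists, not_and] at hcon
    refine hω (mem_H1_of_forall_lt hC0.le ω (fun T hT => (not_le.1 (hcon.1 T hT).1).le)
      (fun p => ?_) (fun T hT => (not_le.1 (hcon.1 T hT).2).le) hL)
    have : |∑ q ∈ {p}, (corrMul ρ (zipArr ω.1 q.1 q.2) - ρ)| ≤ C * (1 : ℝ) * √(√n * √n) :=
      (not_le.1 (hcon.2 p)).le
    rwa [Real.sqrt_mul_self (Real.sqrt_nonneg _), Finset.sum_singleton, mul_one] at this
  calc _ ≤ (μ n d).real _ := measureReal_mono hsub
    _ ≤ _ := measureReal_union_le _ _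
    _ ≤ ∑ T ∈ (univ : Finset (Finset (Fin n))).filter (·.Nonempty), (μ n d).real (G T ∪ F T) +
          ∑ p ∈ (univ : Finset (Fin n × Fin n)), (μ n d).real (E p) :=
        add_le_add (measureReal_biUnion_finset_le _ _) (measureReal_biUnion_finset_le _ _)
    _ ≤ ∑ T ∈ (univ : Finset (Finset (Fin n))).filter (·.Nonempty), 4 * exp (-3 * (#T * L T)) +
          ∑ p ∈ (univ : Finset (Fin n × Fin n)), 2 * exp (-3 * √n) := by
        refine add_le_add (Finset.sum_le_sum fun T hT => ?_) (Finset.sum_le_sum fun p _ => hE p)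
        have hT' := (Finset.mem_filter.1 hT).2
        linarith [measureReal_union_le (μ := μ n d) (G T) (F T), hG T hT', hF T hT']
    _ ≤ 4 * (1 / n) + 2 * (1 / n) := by
        rw [← Finset.mul_sum]
        refine add_le_add (by gcongr; exact sum_exp_neg_le hn) ?_
        rw [Finset.sum_const, Finset.card_univ, Fintype.card_prod, Fintype.card_fin, nsmul_eq_mul]
        have := sq_mul_exp_neg_sqrt_le hn
        push_cast
        linarith
    _ = 6 / n := by ring

end CGM

open CGM in
/-- **Concentration of `V*_G` and `V*_F` (Lemma 3.2).**  There is a universal constant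
`C > 0` such that the event `H1` occurs with probability `1 − o(1)`. -/
theorem H1_whp (d : ℕ → ℕ) (ρ η : ℕ → ℝ)
    (hρ : ∀ n, ρ n ∈ Set.Icc (-1 : ℝ) 1) (hη : ∀ n, η n ∈ Set.Icc (-1 : ℝ) 1) :
    ∃ C > (0 : ℝ),
      Tendsto (fun n => μ n (d n) (H1 C n (d n) (ρ n) (η n))) atTop (𝓝 1) := by
  obtain ⟨C, hC, hle⟩ := exists_measure_compl_H1_le
  refine ⟨C, hC, ?_⟩
  have h0 : Tendsto (fun n : ℕ => 1 - ENNReal.ofReal (6 / n)) atTop (𝓝 1) := by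
    have h := ENNReal.tendsto_ofReal (tendsto_const_div_atTop_nhds_zero_nat (6 : ℝ))
    rw [ENNReal.ofReal_zero] at h
    simpa using ENNReal.Tendsto.sub (tendsto_const_nhds (x := (1 : ENNReal))) h
      (Or.inl ENNReal.one_ne_top)
  refine tendsto_of_tendsto_of_tendsto_of_le_of_le' h0 tendsto_const_nhds ?_
    (Eventually.of_forall fun n => prob_le_one)
  filter_upwards [eventually_gt_atTop 0] with n hn
  rw [tsub_le_iff_right]
  calc (1 : ENNReal) = μ n (d n) Set.univ := measure_univ.symm
    _ = μ n (d n) (H1 C n (d n) (ρ n) (η n) ∪ (H1 C n (d n) (ρ n) (η n))ᶜ) := by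
        rw [Set.union_compl_self]
    _ ≤ _ := measure_union_le _ _
    _ ≤ _ := by
        gcongr
        rw [← ofReal_measureReal]
        exact ENNReal.ofReal_le_ofReal (hle n (d n) hn _ (hρ n) _ (hη n))
end
end

section
/- (Laplace transform bounds for V_G and V_F.) In the Gaussian contextual graph matching model with π* = id, there exist a universal constant C > 0 and an event H2, measurable with respect to (B,Y) alone, occurring with probability 1 − o(1), such that for all π ∈ S_n: E[exp((ρ/(1−ρ²)) V_G(π)) 1_{H2}] ≤ exp( (ρ²/(2(1−ρ²))) ( |D^E_π| + C |D_π| √(n log n) ) ) and E[exp((η/(1−η²)) V_F(π)) 1_{H2}] ≤ exp( (η²/(2(1−η²))) ( d|D_π| + C |D_π| √(max{d, log n} · log n) ) ). -/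
open MeasureTheory ProbabilityTheory Real Filter Finset Topology

noncomputable section

namespace CGM

section GaussianArrays

variable {ι : Type*} [Fintype ι]

/-- The law of an i.i.d. standard Gaussian family indexed by `ι`. -/
def stdGaussPi (ι : Type*) [Fintype ι] : Measure (ι → ℝ) :=
  Measure.pi fun _ => gaussianReal 0 1

instance : IsProbabilityMeasure (stdGaussPi ι) := by
  unfold stdGaussPi; infer_instance

lemma lintegral_exp_mul_gaussianReal (c : ℝ) :
    ∫⁻ z, ENNReal.ofReal (exp (c * z)) ∂gaussianReal 0 1 = ENNReal.ofReal (exp (c ^ 2 / 2)) := by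
  rw [← ofReal_integral_eq_lintegral_ofReal (integrable_exp_mul_gaussianReal c)
    (ae_of_all _ fun z => (exp_pos _).le)]
  have h := congrFun (mgf_fun_id_gaussianReal (μ := 0) (v := 1)) c
  simp only [mgf] at h
  rw [h]
  simp

lemma inv_one_sub_le_exp {u : ℝ} (h0 : 0 ≤ u) (h1 : u ≤ 1 / 2) :
    1 / (1 - u) ≤ exp (u + u ^ 2) := by
  rw [div_le_iff₀ (by linarith)]
  have h := Real.quadratic_le_exp_of_nonneg (x := u + u ^ 2) (by positivity)
  have h2 : (1 + (u + u ^ 2) + (u + u ^ 2) ^ 2 / 2) * (1 - u) ≤ exp (u + u ^ 2) * (1 - u) :=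
    mul_le_mul_of_nonneg_right h (by linarith)
  have h3 : 0 ≤ 1 - u - u ^ 2 - u ^ 3 := by nlinarith [mul_nonneg h0 h0]
  have h4 : 0 ≤ u ^ 2 * (1 - u - u ^ 2 - u ^ 3) := by positivity
  nlinarith

lemma lintegral_exp_mul_sq_gaussianReal_le {s : ℝ} (h0 : 0 ≤ s) (h1 : s ≤ 1 / 4) :
    ∫⁻ z, ENNReal.ofReal (exp (s * z ^ 2)) ∂gaussianReal 0 1
      ≤ ENNReal.ofReal (exp (s + 2 * s ^ 2)) := by
  have hb : 0 < 1 / 2 - s := by linarith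
  rw [gaussianReal_of_var_ne_zero _ one_ne_zero,
    lintegral_withDensity_eq_lintegral_mul _ (measurable_gaussianPDF _ _) (by fun_prop)]
  have h : ∀ z : ℝ, (gaussianPDF 0 1 * fun z => ENNReal.ofReal (exp (s * z ^ 2))) z
      = ENNReal.ofReal ((√(2 * π))⁻¹ * exp (-(1 / 2 - s) * z ^ 2)) := by
    intro z
    simp only [Pi.mul_apply, gaussianPDF, gaussianPDFReal]
    rw [← ENNReal.ofReal_mul (by positivity), mul_assoc, ← exp_add]
    congr 3
    · simp
    · simp; ring
  simp_rw [h]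
  rw [← ofReal_integral_eq_lintegral_ofReal ((integrable_exp_neg_mul_sq hb).const_mul _)
    (ae_of_all _ fun z => by positivity), integral_const_mul, integral_gaussian]
  apply ENNReal.ofReal_le_ofReal
  have h2 : (√(2 * π))⁻¹ * √(π / (1 / 2 - s)) = √(1 / (1 - 2 * s)) := by
    rw [← Real.sqrt_inv, ← Real.sqrt_mul (by positivity)]
    congr 1
    have : (1 - 2 * s) ≠ 0 := by linarith
    field_simp
  rw [h2, Real.sqrt_le_left (exp_pos _).le, ← Real.exp_nat_mul]
  refine (inv_one_sub_le_exp (u := 2 * s) (by linarith) (by linarith)).trans (le_of_eq ?_)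
  congr 1
  push_cast
  ring

lemma lintegral_exp_sum_stdGaussPi (M : Finset ι) (g : ι → ℝ → ℝ) (hg : ∀ e, Measurable (g e)) :
    ∫⁻ x, ENNReal.ofReal (exp (∑ e ∈ M, g e (x e))) ∂stdGaussPi ι
      = ∏ e ∈ M, ∫⁻ z, ENNReal.ofReal (exp (g e z)) ∂gaussianReal 0 1 := by
  have hind : iIndepFun (fun e (x : ι → ℝ) => ENNReal.ofReal (exp (g e (x e)))) (stdGaussPi ι) :=
    iIndepFun_pi (X := fun e z => ENNReal.ofReal (exp (g e z)))
      fun e => Measurable.aemeasurable (by fun_prop)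
  have h := lintegral_prod_eq_prod_lintegral_of_indepFun M _ hind (fun e => by fun_prop)
  simp_rw [Real.exp_sum, ENNReal.ofReal_prod_of_nonneg fun e _ => (exp_pos _).le]
  rw [h]
  refine Finset.prod_congr rfl fun e _ => ?_
  have hmp : MeasurePreserving (Function.eval e) (stdGaussPi ι) (gaussianReal 0 1) :=
    measurePreserving_eval (fun _ : ι => gaussianReal 0 1) e
  exact hmp.lintegral_comp (f := fun z => ENNReal.ofReal (exp (g e z))) (by fun_prop)

lemma lintegral_exp_linear_stdGaussPi (M : Finset ι) (c : ι → ℝ) :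
    ∫⁻ x, ENNReal.ofReal (exp (∑ e ∈ M, c e * x e)) ∂stdGaussPi ι
      = ENNReal.ofReal (exp (∑ e ∈ M, c e ^ 2 / 2)) := by
  rw [lintegral_exp_sum_stdGaussPi M (fun e z => c e * z) (fun e => by fun_prop), Real.exp_sum,
    ENNReal.ofReal_prod_of_nonneg fun e _ => (exp_pos _).le]
  exact Finset.prod_congr rfl fun e _ => lintegral_exp_mul_gaussianReal _

lemma lintegral_exp_sum_sq_stdGaussPi_le (M : Finset ι) {s : ℝ} (h0 : 0 ≤ s) (h1 : s ≤ 1 / 4) :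
    ∫⁻ x, ENNReal.ofReal (exp (∑ e ∈ M, s * x e ^ 2)) ∂stdGaussPi ι
      ≤ ENNReal.ofReal (exp (M.card * (s + 2 * s ^ 2))) := by
  rw [lintegral_exp_sum_stdGaussPi M (fun e z => s * z ^ 2) (fun e => by fun_prop),
    Finset.prod_const, Real.exp_nat_mul, ENNReal.ofReal_pow (exp_pos _).le]
  gcongr
  exact lintegral_exp_mul_sq_gaussianReal_le h0 h1

lemma measurePreserving_piecewise [DecidableEq ι] (M : Finset ι) :
    MeasurePreserving (fun p : (ι → ℝ) × (ι → ℝ) => fun e => if e ∈ M then p.2 e else p.1 e)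
      ((stdGaussPi ι).prod (stdGaussPi ι)) (stdGaussPi ι) := by
  have hm : Measurable
      (fun p : (ι → ℝ) × (ι → ℝ) => fun e => if e ∈ M then p.2 e else p.1 e) := by
    refine measurable_pi_iff.2 fun e => ?_
    split_ifs <;> fun_prop
  refine ⟨hm, (Measure.pi_eq fun s hs => ?_).symm⟩
  rw [Measure.map_apply hm (MeasurableSet.univ_pi hs)]
  have : (fun p : (ι → ℝ) × (ι → ℝ) => fun e => if e ∈ M then p.2 e else p.1 e) ⁻¹'
      Set.univ.pi s = (Set.univ.pi fun e => if e ∈ M then Set.univ else s e) ×ˢ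
        (Set.univ.pi fun e => if e ∈ M then s e else Set.univ) := by
    ext p
    simp only [Set.mem_preimage, Set.mem_univ_pi, Set.mem_prod, ← forall_and]
    refine forall_congr' fun e => ?_
    split_ifs <;> simp
  rw [this, Measure.prod_prod, stdGaussPi, Measure.pi_pi, Measure.pi_pi, ← Finset.prod_mul_distrib]
  refine Finset.prod_congr rfl fun e _ => ?_
  split_ifs <;> simp

lemma lintegral_exp_sum_mul_stdGaussPi_le (M : Finset ι) (σ : ι → ι) (hinj : Set.InjOn σ M)
    (hM : ∀ e ∈ M, σ e ∉ M) {t : ℝ} (h0 : 0 ≤ t) (h1 : t ≤ 1 / 4) :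
    ∫⁻ x, ENNReal.ofReal (exp (∑ e ∈ M, t * (x (σ e) * x e))) ∂stdGaussPi ι
      ≤ ENNReal.ofReal (exp (2 * M.card * t ^ 2)) := by
  classical
  have hf : Measurable fun x : ι → ℝ =>
      ENNReal.ofReal (exp (∑ e ∈ M, t * (x (σ e) * x e))) := by fun_prop
  rw [← (measurePreserving_piecewise M).lintegral_comp hf,
    lintegral_prod]
  swap
  · exact (hf.comp (measurePreserving_piecewise M).measurable).aemeasurable
  have h : ∀ x : ι → ℝ, ∫⁻ w, ENNReal.ofReal (exp (∑ e ∈ M,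
      t * ((if σ e ∈ M then w (σ e) else x (σ e)) * (if e ∈ M then w e else x e)))) ∂stdGaussPi ι
      = ENNReal.ofReal (exp (∑ e ∈ M.image σ, (t ^ 2 / 2) * x e ^ 2)) := by
    intro x
    rw [Finset.sum_image hinj]
    have := lintegral_exp_linear_stdGaussPi M (fun e => t * x (σ e))
    refine Eq.trans (lintegral_congr fun w => ?_) (this.trans ?_)
    · congr 2
      refine Finset.sum_congr rfl fun e he => ?_
      rw [if_pos he, if_neg (hM e he)]
      ring
    · congr 2
      exact Finset.sum_congr rfl fun e _ => by ring
  simp_rw [h]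
  refine (lintegral_exp_sum_sq_stdGaussPi_le _ (by positivity) (by nlinarith)).trans ?_
  rw [Finset.card_image_of_injOn hinj]
  apply ENNReal.ofReal_le_ofReal
  apply exp_le_exp.2
  have : t ^ 2 / 2 + 2 * (t ^ 2 / 2) ^ 2 ≤ 2 * t ^ 2 := by
    nlinarith [mul_nonneg h0 h0, mul_nonneg (mul_nonneg h0 h0) (sub_nonneg.2 h1)]
  nlinarith [mul_le_mul_of_nonneg_left this (Nat.cast_nonneg (α := ℝ) M.card)]

omit [Fintype ι] in
lemma exists_three_coloring (M : Finset ι) (σ : ι → ι) (hinj : Set.InjOn σ M)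
    (hne : ∀ e ∈ M, σ e ≠ e) :
    ∃ c : ι → Fin 3, ∀ e ∈ M, σ e ∈ M → c (σ e) ≠ c e := by
  classical
  induction M using Finset.induction_on with
  | empty => exact ⟨fun _ => 0, by simp⟩
  | insert a s ha ih =>
    obtain ⟨c, hc⟩ := ih (hinj.mono (by simp)) fun e he => hne e (Finset.mem_insert_of_mem he)
    have hk : ∀ p q : Fin 3, ∃ k, k ≠ p ∧ k ≠ q := by decide
    obtain ⟨q, hq⟩ : ∃ q : Fin 3, ∀ b ∈ s, σ b = a → c b = q := by
      by_cases hb : ∃ b ∈ s, σ b = a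
      · obtain ⟨b, hbs, hb⟩ := hb
        refine ⟨c b, fun b' hb's hb' => ?_⟩
        rw [hinj (by simp [hb's]) (by simp [hbs]) (hb'.trans hb.symm)]
      · exact ⟨0, fun b hbs hba => (hb ⟨b, hbs, hba⟩).elim⟩
    obtain ⟨k, hkp, hkq⟩ := hk (c (σ a)) q
    refine ⟨Function.update c a k, fun e he hσe => ?_⟩
    rcases Finset.mem_insert.1 he with rfl | hes
    · rw [Function.update_of_ne (hne _ he), Function.update_self]
      exact hkp.symm
    · have hea : e ≠ a := fun h => ha (h ▸ hes)
      rw [Function.update_of_ne hea]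
      rcases Finset.mem_insert.1 hσe with h | h
      · rw [h, Function.update_self, hq e hes h]
        exact hkq
      · rw [Function.update_of_ne fun h' : σ e = a => ha (h' ▸ h)]
        exact hc e hes h

lemma measure_lt_le_exp_mul_lintegral {Ω : Type*} [MeasurableSpace Ω] (P : Measure Ω)
    {f : Ω → ℝ} (hf : Measurable f) {t : ℝ} (ht : 0 ≤ t) (u : ℝ) :
    P {x | u < f x}
      ≤ ENNReal.ofReal (exp (-(t * u))) * ∫⁻ x, ENNReal.ofReal (exp (t * f x)) ∂P := by
  rw [← lintegral_const_mul _ (by fun_prop), ← lintegral_indicator_one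
    (measurableSet_lt measurable_const hf)]
  refine lintegral_mono fun x => ?_
  rw [← ENNReal.ofReal_mul (exp_pos _).le, ← exp_add]
  by_cases hx : u < f x
  · rw [Set.indicator_of_mem (by exact hx), Pi.one_apply, ← ENNReal.ofReal_one]
    apply ENNReal.ofReal_le_ofReal
    rw [Real.one_le_exp_iff]
    nlinarith
  · rw [Set.indicator_of_notMem (by exact hx)]
    exact zero_le

/-- Chernoff bound for the quadratic form `∑ (2 x (σ e) x e + x (σ e) ^ 2)`. -/
lemma stdGaussPi_quadratic_tail (M : Finset ι) (σ : ι → ι) (hinj : Set.InjOn σ M)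
    (hne : ∀ e ∈ M, σ e ≠ e) {t : ℝ} (h0 : 0 ≤ t) (h1 : t ≤ 1 / 4) (u : ℝ) :
    stdGaussPi ι {x | M.card + 7 * u < ∑ e ∈ M, (2 * (x (σ e) * x e) + x (σ e) ^ 2)}
      ≤ 4 * ENNReal.ofReal (exp (2 * M.card * t ^ 2 - t * u)) := by
  classical
  obtain ⟨c, hc⟩ := exists_three_coloring M σ hinj hne
  set T : Fin 3 → (ι → ℝ) → ℝ := fun k x => ∑ e ∈ M with c e = k, x (σ e) * x e with hT
  set R : (ι → ℝ) → ℝ := fun x => ∑ e ∈ M.image σ, x e ^ 2 with hR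
  have hTm : ∀ k, Measurable (T k) := fun k => by fun_prop
  have hRm : Measurable R := by fun_prop
  have hsub : {x : ι → ℝ | M.card + 7 * u < ∑ e ∈ M, (2 * (x (σ e) * x e) + x (σ e) ^ 2)}
      ⊆ (⋃ k, {x | u < T k x}) ∪ {x | M.card + u < R x} := by
    intro x hx
    by_contra hcon
    simp only [Set.mem_union, Set.mem_iUnion, Set.mem_ofPred_eq, not_or, not_exists, not_lt] at hcon
    have hsum : ∑ e ∈ M, x (σ e) * x e = ∑ k, T k x := (Finset.sum_fiberwise M c _).symm
    simp only [Set.mem_ofPred_eq, Finset.sum_add_distrib, ← Finset.mul_sum] at hx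
    rw [hsum, Fin.sum_univ_three, ← Finset.sum_image (f := fun e => x e ^ 2) hinj] at hx
    have := hcon.1 0
    have := hcon.1 1
    have := hcon.1 2
    have := hcon.2
    simp only [hR] at this
    linarith
  have hTk : ∀ k, stdGaussPi ι {x | u < T k x}
      ≤ ENNReal.ofReal (exp (2 * M.card * t ^ 2 - t * u)) := by
    intro k
    refine (measure_lt_le_exp_mul_lintegral _ (hTm k) h0 u).trans ?_
    simp only [hT, Finset.mul_sum]
    have h := lintegral_exp_sum_mul_stdGaussPi_le (M.filter fun e => c e = k) σ
      (hinj.mono (Finset.coe_subset.2 (Finset.filter_subset _ _))) (fun e he hσe => by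
        simp only [Finset.mem_filter] at he hσe
        exact hc e he.1 hσe.1 (hσe.2.trans he.2.symm)) h0 h1
    refine (mul_le_mul_right h _).trans ?_
    rw [← ENNReal.ofReal_mul (exp_pos _).le, ← exp_add]
    apply ENNReal.ofReal_le_ofReal
    apply exp_le_exp.2
    have : ((M.filter fun e => c e = k).card : ℝ) ≤ M.card :=
      mod_cast Finset.card_filter_le _ _
    nlinarith [mul_le_mul_of_nonneg_right this (sq_nonneg t)]
  have hRb : stdGaussPi ι {x | M.card + u < R x}
      ≤ ENNReal.ofReal (exp (2 * M.card * t ^ 2 - t * u)) := by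
    refine (measure_lt_le_exp_mul_lintegral _ hRm h0 _).trans ?_
    simp only [hR, Finset.mul_sum]
    refine (mul_le_mul_right (lintegral_exp_sum_sq_stdGaussPi_le _ h0 h1) _).trans ?_
    rw [← ENNReal.ofReal_mul (exp_pos _).le, ← exp_add, Finset.card_image_of_injOn hinj]
    apply ENNReal.ofReal_le_ofReal
    apply exp_le_exp.2
    linarith
  calc _ ≤ (∑ k, stdGaussPi ι {x | u < T k x}) + stdGaussPi ι {x | M.card + u < R x} :=
        (measure_mono hsub).trans ((measure_union_le _ _).trans
          (by gcongr; exact measure_iUnion_fintype_le _ _))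
    _ ≤ _ := by
        refine (add_le_add (Finset.sum_le_sum fun k _ => hTk k) hRb).trans (le_of_eq ?_)
        simp only [Finset.sum_const, Finset.card_univ, Fintype.card_fin, nsmul_eq_mul]
        push_cast
        ring

/-- Tail bound at the scale used for the union bound over permutations. -/
lemma stdGaussPi_quadratic_tail_of_card_le (M : Finset ι) (σ : ι → ι) (hinj : Set.InjOn σ M)
    (hne : ∀ e ∈ M, σ e ≠ e) {k N L : ℝ} (hk : 0 ≤ k) (hL : 0 ≤ L) (hLN : L ≤ N)
    (hM : M.card ≤ k * N) :
    stdGaussPi ι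
        {x | M.card + 91 * k * √(N * L) < ∑ e ∈ M, (2 * (x (σ e) * x e) + x (σ e) ^ 2)}
      ≤ 4 * ENNReal.ofReal (exp (-(3 * L * k))) := by
  rcases hL.eq_or_lt with rfl | hLpos
  · have h := stdGaussPi_quadratic_tail M σ hinj hne (t := 0) le_rfl (by norm_num) 0
    simpa using h
  have hN : 0 < N := hLpos.trans_le hLN
  have ht1 : √(L / N) / 4 ≤ 1 / 4 := by
    have : √(L / N) ≤ 1 := Real.sqrt_le_one.2 ((div_le_one hN).2 hLN)
    linarith
  have h := stdGaussPi_quadratic_tail M σ hinj hne (t := √(L / N) / 4) (by positivity) ht1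
    (13 * k * √(N * L))
  rw [show 7 * (13 * k * √(N * L)) = 91 * k * √(N * L) by ring] at h
  refine h.trans ?_
  gcongr
  have h2 : √(L / N) * √(N * L) = L := by
    rw [← Real.sqrt_mul (by positivity), show L / N * (N * L) = L ^ 2 by field_simp,
      Real.sqrt_sq hL]
  have h3 : (√(L / N) / 4) ^ 2 = L / N / 16 := by
    rw [div_pow, Real.sq_sqrt (by positivity)]; norm_num
  have h4 : 2 * (M.card : ℝ) * (√(L / N) / 4) ^ 2 ≤ k * L / 8 := by
    rw [h3]
    calc 2 * (M.card : ℝ) * (L / N / 16) ≤ 2 * (k * N) * (L / N / 16) := by gcongr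
      _ = k * L / 8 := by field_simp; ring
  have h5 : √(L / N) / 4 * (13 * k * √(N * L)) = 13 / 4 * (k * L) := by
    linear_combination (13 / 4 * k) * h2
  have : 0 ≤ k * L := by positivity
  linarith

/-- Conditional Laplace transform: if `x` and `w` are independent and the quadratic form of `x` is
at most `K` on `S`, integrating `w` out bounds the restricted exponential moment. -/
lemma lintegral_exp_bilinear_le (M : Finset ι) (σ : ι → ι) {ρ : ℝ} (hρ : ρ ^ 2 ≤ 1) {K : ℝ}
    {S : Set (ι → ℝ)} (hS : MeasurableSet S)
    (hSK : ∀ x ∈ S, ∑ e ∈ M, (2 * (x (σ e) * x e) + x (σ e) ^ 2) ≤ K) :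
    ∫⁻ p, ENNReal.ofReal (exp (ρ / (1 - ρ ^ 2) *
        ∑ e ∈ M, p.1 (σ e) * (ρ * p.1 e - √(1 - ρ ^ 2) * p.2 e))) * S.indicator 1 p.1
        ∂(stdGaussPi ι).prod (stdGaussPi ι)
      ≤ ENNReal.ofReal (exp (ρ ^ 2 / (2 * (1 - ρ ^ 2)) * K)) := by
  have hind : Measurable (S.indicator (1 : (ι → ℝ) → ENNReal)) := measurable_one.indicator hS
  rw [lintegral_prod _ (Measurable.aemeasurable (by fun_prop))]
  calc _ ≤ ∫⁻ _, ENNReal.ofReal (exp (ρ ^ 2 / (2 * (1 - ρ ^ 2)) * K)) ∂stdGaussPi ι := ?_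
    _ = _ := by simp
  refine lintegral_mono fun x => ?_
  by_cases hx : x ∈ S
  swap
  · simp [hx]
  simp only [Set.indicator_of_mem hx, Pi.one_apply, mul_one]
  have hsplit : ∀ w : ι → ℝ, ENNReal.ofReal (exp (ρ / (1 - ρ ^ 2) *
      ∑ e ∈ M, x (σ e) * (ρ * x e - √(1 - ρ ^ 2) * w e)))
      = ENNReal.ofReal (exp (ρ ^ 2 / (1 - ρ ^ 2) * ∑ e ∈ M, x (σ e) * x e)) *
        ENNReal.ofReal (exp (∑ e ∈ M,
          (-(ρ / (1 - ρ ^ 2) * √(1 - ρ ^ 2) * x (σ e))) * w e)) := by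
    intro w
    rw [← ENNReal.ofReal_mul (exp_pos _).le, ← exp_add, Finset.mul_sum, Finset.mul_sum,
      ← Finset.sum_add_distrib]
    congr 2
    exact Finset.sum_congr rfl fun e _ => by ring
  simp_rw [hsplit]
  rw [lintegral_const_mul _ (by fun_prop), lintegral_exp_linear_stdGaussPi,
    ← ENNReal.ofReal_mul (exp_pos _).le, ← exp_add]
  apply ENNReal.ofReal_le_ofReal
  apply exp_le_exp.2
  have hcoef : 0 ≤ ρ ^ 2 / (2 * (1 - ρ ^ 2)) := div_nonneg (sq_nonneg _) (by linarith)
  refine le_trans (le_of_eq ?_) (mul_le_mul_of_nonneg_left (hSK x hx) hcoef)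
  rw [Finset.mul_sum, Finset.mul_sum, ← Finset.sum_add_distrib]
  refine Finset.sum_congr rfl fun e _ => ?_
  rw [neg_sq, mul_pow, mul_pow, Real.sq_sqrt (by linarith)]
  by_cases h : 1 - ρ ^ 2 = 0
  · simp [h]
  · field_simp

lemma integral_exp_mul_indicator_le {Ω : Type*} [MeasurableSpace Ω] {P : Measure Ω}
    {Ψ : Ω → (ι → ℝ) × (ι → ℝ)}
    (hΨ : MeasurePreserving Ψ P ((stdGaussPi ι).prod (stdGaussPi ι))) (M : Finset ι) (σ : ι → ι)
    {ρ : ℝ} (hρ : ρ ^ 2 ≤ 1) {K : ℝ} {S : Set (ι → ℝ)} (hS : MeasurableSet S)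
    (hSK : ∀ x ∈ S, ∑ e ∈ M, (2 * (x (σ e) * x e) + x (σ e) ^ 2) ≤ K)
    {H : Set Ω} (hH : ∀ ω ∈ H, (Ψ ω).1 ∈ S) {v : Ω → ℝ}
    (hv : ∀ ω, v ω = ∑ e ∈ M, (Ψ ω).1 (σ e) * (ρ * (Ψ ω).1 e - √(1 - ρ ^ 2) * (Ψ ω).2 e)) :
    ∫ ω, exp (ρ / (1 - ρ ^ 2) * v ω) * H.indicator (fun _ => 1) ω ∂P
      ≤ exp (ρ ^ 2 / (2 * (1 - ρ ^ 2)) * K) := by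
  rw [← ENNReal.ofReal_le_ofReal_iff (exp_pos _).le]
  refine Real.ofReal_le_enorm _ |>.trans ((enorm_integral_le_lintegral_enorm _).trans ?_)
  refine le_trans ?_ (lintegral_exp_bilinear_le M σ hρ hS hSK)
  have hind : Measurable (S.indicator (1 : (ι → ℝ) → ENNReal)) := measurable_one.indicator hS
  rw [← hΨ.lintegral_comp (by fun_prop)]
  refine lintegral_mono fun ω => ?_
  by_cases hω : ω ∈ H
  · simp only [Set.indicator_of_mem hω, Set.indicator_of_mem (hH ω hω), mul_one, Pi.one_apply,
      hv ω]
    rw [Real.enorm_of_nonneg (exp_pos _).le]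
  · simp [hω]

/-- The pair `(x, w)` obtained by rotating `(a, z)`, so that `x = ρ a + √(1 - ρ²) z` and
`a = ρ x - √(1 - ρ²) w`. -/
def rotatePair (ρ : ℝ) (p : (ι → ℝ) × (ι → ℝ)) : (ι → ℝ) × (ι → ℝ) :=
  (fun e => ρ * p.1 e + √(1 - ρ ^ 2) * p.2 e, fun e => -√(1 - ρ ^ 2) * p.1 e + ρ * p.2 e)

omit [Fintype ι] in
lemma rotatePair_inv {ρ : ℝ} (hρ : ρ ^ 2 ≤ 1) (p : (ι → ℝ) × (ι → ℝ)) (e : ι) :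
    ρ * (rotatePair ρ p).1 e - √(1 - ρ ^ 2) * (rotatePair ρ p).2 e = p.1 e := by
  have h : √(1 - ρ ^ 2) ^ 2 = 1 - ρ ^ 2 := Real.sq_sqrt (by linarith)
  simp only [rotatePair]
  linear_combination p.1 e * h

lemma stdGaussPi_eq_map :
    stdGaussPi ι = (stdGaussian (EuclideanSpace ℝ ι)).map (EuclideanSpace.equiv ι ℝ) := by
  rw [← map_pi_eq_stdGaussian, Measure.map_map (by fun_prop) (by fun_prop)]
  exact Measure.map_id.symm

instance : IsGaussian (stdGaussPi ι) := by
  rw [stdGaussPi_eq_map]; infer_instance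

lemma integral_id_stdGaussPi : (stdGaussPi ι)[id] = 0 := by
  rw [stdGaussPi_eq_map, integral_map (by fun_prop) (by fun_prop)]
  exact ((EuclideanSpace.equiv ι ℝ).toContinuousLinearMap.integral_comp_comm
    IsGaussian.integrable_id).trans (by simp)

lemma measurePreserving_rotatePair {ρ : ℝ} (hρ : ρ ∈ Set.Icc (-1 : ℝ) 1) :
    MeasurePreserving (rotatePair ρ) ((stdGaussPi ι).prod (stdGaussPi ι))
      ((stdGaussPi ι).prod (stdGaussPi ι)) := by
  have h := IsGaussian.map_rotation_eq_self (integral_id_stdGaussPi (ι := ι)) (arccos ρ)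
  have heq : ⇑(ContinuousLinearMap.rotation (E := ι → ℝ) (arccos ρ)) = rotatePair ρ := by
    funext p
    rw [ContinuousLinearMap.rotation_apply, cos_arccos hρ.1 hρ.2, sin_arccos]
    rfl
  rw [heq] at h
  exact ⟨heq ▸ (ContinuousLinearMap.rotation (E := ι → ℝ) (arccos ρ)).continuous.measurable, h⟩

lemma measurePreserving_uncurry (κ : Type*) [Fintype κ] :
    MeasurePreserving (Function.uncurry : (ι → κ → ℝ) → ι × κ → ℝ)
      (Measure.pi fun _ => Measure.pi fun _ => gaussianReal 0 1) (stdGaussPi (ι × κ)) := by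
  refine ⟨(MeasurableEquiv.curry ι κ ℝ).symm.measurable, ?_⟩
  have h := Measure.infinitePi_map_curry_symm fun (_ : ι) (_ : κ) => gaussianReal 0 1
  simp only [Measure.infinitePi_eq_pi] at h
  exact h

end GaussianArrays

/-! ### Union bound over permutations -/

lemma sum_perm_pow_card_support_le (n : ℕ) {x : ℝ} (hx : 0 ≤ x) :
    ∑ φ : Equiv.Perm (Fin n), x ^ φ.support.card ≤ exp ((n : ℝ) ^ 2 * x) := by
  have h1 : ∑ φ : Equiv.Perm (Fin n), x ^ φ.support.card
      ≤ ∑ f : Fin n → Fin n, ∏ i, (if f i = i then 1 else x) := by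
    have hterm : ∀ φ : Equiv.Perm (Fin n),
        x ^ φ.support.card = ∏ i, (if φ i = i then 1 else x) := by
      intro φ
      rw [Finset.prod_ite, Finset.prod_const_one, one_mul, Finset.prod_const]
      rfl
    simp_rw [hterm]
    rw [← Finset.sum_image (s := Finset.univ) (g := fun φ : Equiv.Perm (Fin n) => ⇑φ)
      (f := fun f : Fin n → Fin n => ∏ i, (if f i = i then 1 else x))
      (fun a _ b _ h => DFunLike.coe_injective h)]
    refine Finset.sum_le_sum_of_subset_of_nonneg (Finset.subset_univ _) fun f _ _ => ?_
    exact Finset.prod_nonneg fun i _ => by split_ifs <;> positivity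
  refine h1.trans ?_
  rw [← Fintype.prod_sum fun (i j : Fin n) => if j = i then (1 : ℝ) else x]
  have h2 : ∀ i : Fin n, ∑ j : Fin n, (if j = i then (1 : ℝ) else x) ≤ exp (n * x) := by
    intro i
    have : ∑ j : Fin n, (if j = i then (1 : ℝ) else x)
        ≤ ∑ j : Fin n, ((if j = i then (1 : ℝ) else 0) + x) :=
      Finset.sum_le_sum fun j _ => by split_ifs <;> linarith
    refine this.trans ?_
    rw [Finset.sum_add_distrib]
    simp only [Finset.sum_ite_eq', Finset.mem_univ, if_true, Finset.sum_const, Finset.card_univ,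
      Fintype.card_fin, nsmul_eq_mul]
    linarith [Real.add_one_le_exp (n * x)]
  calc _ ≤ ∏ _i : Fin n, exp (n * x) :=
        Finset.prod_le_prod (fun i _ => Finset.sum_nonneg fun j _ => by split_ifs <;> positivity)
          fun i _ => h2 i
    _ = _ := by
        rw [Finset.prod_const, Finset.card_univ, Fintype.card_fin, ← Real.exp_nat_mul]
        congr 1
        ring

lemma sum_perm_ne_one_pow_card_support_le (n : ℕ) {x : ℝ} (hx : 0 ≤ x) :
    ∑ φ : Equiv.Perm (Fin n) with φ ≠ 1, x ^ φ.support.card ≤ exp ((n : ℝ) ^ 2 * x) - 1 := by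
  have h := sum_perm_pow_card_support_le n hx
  rw [← Finset.sum_filter_add_sum_filter_not _ (fun φ : Equiv.Perm (Fin n) => φ ≠ 1)] at h
  simp only [not_not, Finset.filter_eq', Finset.mem_univ, if_true, Finset.sum_singleton,
    Equiv.Perm.support_one, Finset.card_empty, pow_zero] at h
  linarith

section UnionBound

variable {ι : Type*} [Fintype ι]

/-- Arrays for which the quadratic forms attached to all permutations are simultaneously close to
their means. -/
def goodArrays (n : ℕ) (M : Equiv.Perm (Fin n) → Finset ι) (σ : Equiv.Perm (Fin n) → ι → ι)
    (N L : ℝ) : Set (ι → ℝ) :=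
  {x | ∀ φ : Equiv.Perm (Fin n), ∑ e ∈ M φ, (2 * (x (σ φ e) * x e) + x (σ φ e) ^ 2)
    ≤ (M φ).card + 91 * φ.support.card * √(N * L)}

omit [Fintype ι] in
lemma measurableSet_goodArrays (n : ℕ) (M : Equiv.Perm (Fin n) → Finset ι)
    (σ : Equiv.Perm (Fin n) → ι → ι) (N L : ℝ) : MeasurableSet (goodArrays n M σ N L) := by
  rw [goodArrays, Set.ofPred_forall]
  exact MeasurableSet.iInter fun φ => measurableSet_le (by fun_prop) measurable_const

lemma stdGaussPi_compl_goodArrays_le (n : ℕ) (M : Equiv.Perm (Fin n) → Finset ι)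
    (σ : Equiv.Perm (Fin n) → ι → ι) {N L : ℝ} (hinj : ∀ φ, Set.InjOn (σ φ) (M φ))
    (hne : ∀ φ, ∀ e ∈ M φ, σ φ e ≠ e) (hL : 0 ≤ L) (hLN : L ≤ N)
    (hM : ∀ φ, ((M φ).card : ℝ) ≤ φ.support.card * N) :
    stdGaussPi ι (goodArrays n M σ N L)ᶜ
      ≤ ENNReal.ofReal (4 * (exp ((n : ℝ) ^ 2 * exp (-(3 * L))) - 1)) := by
  have hsub : (goodArrays n M σ N L)ᶜ ⊆
      ⋃ φ ∈ Finset.univ.filter (fun φ : Equiv.Perm (Fin n) => φ ≠ 1),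
        {x | (M φ).card + 91 * φ.support.card * √(N * L)
          < ∑ e ∈ M φ, (2 * (x (σ φ e) * x e) + x (σ φ e) ^ 2)} := by
    intro x hx
    simp only [goodArrays, Set.mem_compl_iff, Set.mem_ofPred_eq, not_forall, not_le] at hx
    obtain ⟨φ, hφ⟩ := hx
    simp only [Set.mem_iUnion, Finset.mem_filter, Finset.mem_univ, true_and, Set.mem_ofPred_eq]
    refine ⟨φ, fun h1 => ?_, hφ⟩
    subst h1
    have hcard : M 1 = ∅ := by
      have := hM 1
      simp only [Equiv.Perm.support_one, Finset.card_empty, Nat.cast_zero, zero_mul] at this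
      exact Finset.card_eq_zero.1 (by exact_mod_cast le_antisymm this (Nat.cast_nonneg _))
    simp [hcard] at hφ
  refine (measure_mono hsub).trans ((measure_biUnion_finset_le _ _).trans ?_)
  calc _ ≤ ∑ φ : Equiv.Perm (Fin n) with φ ≠ 1,
        ENNReal.ofReal (4 * exp (-(3 * L)) ^ φ.support.card) := by
        refine Finset.sum_le_sum fun φ _ => ?_
        refine (stdGaussPi_quadratic_tail_of_card_le (M φ) (σ φ) (hinj φ) (hne φ)
          (Nat.cast_nonneg _) hL hLN (hM φ)).trans (le_of_eq ?_)
        rw [ENNReal.ofReal_mul (by norm_num), ← Real.exp_nat_mul, ENNReal.ofReal_ofNat]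
        congr 3
        ring
    _ = ENNReal.ofReal (4 * ∑ φ : Equiv.Perm (Fin n) with φ ≠ 1,
          exp (-(3 * L)) ^ φ.support.card) := by
        rw [Finset.mul_sum, ENNReal.ofReal_sum_of_nonneg fun φ _ => by positivity]
    _ ≤ _ := by
        gcongr
        exact sum_perm_ne_one_pow_card_support_le n (exp_pos _).le

end UnionBound

/-! ### The action of a permutation on edges -/

/-- The ordered representative of an unordered pair. -/
def sortPair {n : ℕ} (p : Fin n × Fin n) : Fin n × Fin n := if p.1 ≤ p.2 then p else p.swap

lemma sym_eq_uncurry_sortPair {n : ℕ} (f : GW n) (i j : Fin n) :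
    sym f i j = Function.uncurry f (sortPair (i, j)) := by
  unfold sym sortPair
  split_ifs <;> rfl

/-- The map induced by a permutation on ordered representatives of edges. -/
def edgeMap {n : ℕ} (φ : Equiv.Perm (Fin n)) (p : Fin n × Fin n) : Fin n × Fin n :=
  sortPair (φ p.1, φ p.2)

lemma sortPair_sortPair {n : ℕ} (p : Fin n × Fin n) : sortPair (sortPair p) = sortPair p := by
  rcases le_total p.1 p.2 with h | h
  · simp [sortPair, h]
  · rcases h.eq_or_lt with h' | h'
    · simp [sortPair, h'.symm.le]
    · simp [sortPair, h'.not_ge, h]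

lemma sortPair_of_mem_movedEdges {n : ℕ} {φ : Equiv.Perm (Fin n)} {p : Fin n × Fin n}
    (hp : p ∈ movedEdges φ) : sortPair p = p := by
  simp only [movedEdges, Finset.mem_filter] at hp
  simp [sortPair, hp.2.1.le]

lemma edgeMap_injOn {n : ℕ} (φ : Equiv.Perm (Fin n)) : Set.InjOn (edgeMap φ) (movedEdges φ) := by
  rintro ⟨a, b⟩ hp ⟨c, e⟩ hq h
  simp only [movedEdges, Finset.coe_filter, Set.mem_ofPred_eq, Finset.mem_univ, true_and] at hp hq
  have hcases : (φ a = φ c ∧ φ b = φ e) ∨ (φ a = φ e ∧ φ b = φ c) := by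
    simp only [edgeMap, sortPair] at h
    split_ifs at h <;> simp only [Prod.mk.injEq, Prod.swap_prod_mk] at h <;> tauto
  rcases hcases with ⟨h1, h2⟩ | ⟨h1, h2⟩
  · rw [φ.injective h1, φ.injective h2]
  · have := φ.injective h1
    have := φ.injective h2
    subst_vars
    exact absurd hp.1 hq.1.not_gt

lemma edgeMap_ne {n : ℕ} (φ : Equiv.Perm (Fin n)) :
    ∀ p ∈ movedEdges φ, edgeMap φ p ≠ p := by
  rintro ⟨a, b⟩ hp h
  simp only [movedEdges, Finset.mem_filter, Finset.mem_univ, true_and] at hp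
  simp only [edgeMap, sortPair] at h
  split_ifs at h <;> simp only [Prod.mk.injEq, Prod.swap_prod_mk] at h <;> tauto

lemma card_movedEdges_le {n : ℕ} (φ : Equiv.Perm (Fin n)) :
    (movedEdges φ).card ≤ φ.support.card * n := by
  have h : (movedEdges φ).card ≤ (φ.support ×ˢ (Finset.univ : Finset (Fin n))).card := by
    refine Finset.card_le_card_of_injOn (fun p => if φ p.1 = p.1 then p.swap else p) ?_ ?_
    · rintro ⟨a, b⟩ hp
      simp only [movedEdges, Finset.coe_filter, Set.mem_ofPred_eq, Finset.mem_univ,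
        true_and] at hp
      simp only [Finset.coe_product, Set.mem_prod, Finset.mem_coe, Equiv.Perm.mem_support,
        Finset.mem_univ, and_true]
      split_ifs with h
      · exact fun h' => hp.2 (Or.inl ⟨h, h'⟩)
      · exact h
    · rintro ⟨a, b⟩ hp ⟨c, e⟩ hq h
      simp only [movedEdges, Finset.coe_filter, Set.mem_ofPred_eq, Finset.mem_univ,
        true_and] at hp hq
      dsimp only at h
      split_ifs at h <;> simp only [Prod.mk.injEq, Prod.swap_prod_mk] at h ⊢ <;> omega
  simpa using h

/-! ### The model in rotated coordinates -/

lemma Bmat_eq {n d : ℕ} (ρ : ℝ) (ω : Samp n d) (i j : Fin n) :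
    Bmat ρ ω i j = (rotatePair ρ (Prod.map Function.uncurry Function.uncurry ω.1)).1
      (sortPair (i, j)) := by
  simp only [Bmat, Amat, sym_eq_uncurry_sortPair]
  rfl

lemma VG_eq {n d : ℕ} {ρ : ℝ} (hρ : ρ ^ 2 ≤ 1) (φ : Equiv.Perm (Fin n)) (ω : Samp n d) :
    VG ρ φ ω = ∑ e ∈ movedEdges φ,
      (rotatePair ρ (Prod.map Function.uncurry Function.uncurry ω.1)).1 (edgeMap φ e) *
      (ρ * (rotatePair ρ (Prod.map Function.uncurry Function.uncurry ω.1)).1 e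
        - √(1 - ρ ^ 2) *
          (rotatePair ρ (Prod.map Function.uncurry Function.uncurry ω.1)).2 e) := by
  refine Finset.sum_congr rfl fun e he => ?_
  rw [rotatePair_inv hρ, Bmat_eq, Amat, sym_eq_uncurry_sortPair, sortPair_of_mem_movedEdges he]
  rfl

lemma VF_eq {n d : ℕ} {η : ℝ} (hη : η ^ 2 ≤ 1) (φ : Equiv.Perm (Fin n)) (ω : Samp n d) :
    VF η φ ω = ∑ e ∈ φ.support ×ˢ (Finset.univ : Finset (Fin d)),
      (rotatePair η (Prod.map Function.uncurry Function.uncurry ω.2)).1 (φ e.1, e.2) *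
      (η * (rotatePair η (Prod.map Function.uncurry Function.uncurry ω.2)).1 e
        - √(1 - η ^ 2) *
          (rotatePair η (Prod.map Function.uncurry Function.uncurry ω.2)).2 e) := by
  simp_rw [rotatePair_inv hη]
  rw [Finset.sum_product]
  rfl

lemma measurePreserving_rotate_graph (n d : ℕ) {ρ : ℝ} (hρ : ρ ∈ Set.Icc (-1 : ℝ) 1) :
    MeasurePreserving
      (fun ω : Samp n d => rotatePair ρ (Prod.map Function.uncurry Function.uncurry ω.1)) (μ n d)
      ((stdGaussPi (Fin n × Fin n)).prod (stdGaussPi (Fin n × Fin n))) := by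
  unfold μ stdGaussG stdGaussF
  exact (measurePreserving_rotatePair hρ).comp
    (((measurePreserving_uncurry (Fin n)).prod (measurePreserving_uncurry (Fin n))).comp
      measurePreserving_fst)

lemma measurePreserving_rotate_features (n d : ℕ) {η : ℝ} (hη : η ∈ Set.Icc (-1 : ℝ) 1) :
    MeasurePreserving
      (fun ω : Samp n d => rotatePair η (Prod.map Function.uncurry Function.uncurry ω.2)) (μ n d)
      ((stdGaussPi (Fin n × Fin d)).prod (stdGaussPi (Fin n × Fin d))) := by
  unfold μ stdGaussG stdGaussF
  exact (measurePreserving_rotatePair hη).comp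
    (((measurePreserving_uncurry (Fin d)).prod (measurePreserving_uncurry (Fin d))).comp
      measurePreserving_snd)

/-- Good weight arrays `B`. -/
def goodGraphs (n : ℕ) : Set (Fin n × Fin n → ℝ) :=
  goodArrays n movedEdges edgeMap n (log n)

/-- Good feature arrays `Y`. -/
def goodFeatures (n d : ℕ) : Set (Fin n × Fin d → ℝ) :=
  goodArrays n (fun φ => φ.support ×ˢ Finset.univ) (fun φ e => (φ e.1, e.2)) (max d (log n))
    (log n)

lemma uncurry_Bmat_mem_goodGraphs_iff {n d : ℕ} (ρ : ℝ) (ω : Samp n d) :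
    Function.uncurry (Bmat ρ ω) ∈ goodGraphs n ↔
      (rotatePair ρ (Prod.map Function.uncurry Function.uncurry ω.1)).1 ∈ goodGraphs n := by
  refine forall_congr' fun φ => ?_
  have h : ∀ e, Function.uncurry (Bmat ρ ω) e =
      (rotatePair ρ (Prod.map Function.uncurry Function.uncurry ω.1)).1 (sortPair e) :=
    fun e => Bmat_eq ρ ω e.1 e.2
  rw [Finset.sum_congr rfl fun e he => by
    rw [h, h, sortPair_of_mem_movedEdges he, edgeMap, sortPair_sortPair]]
  rfl

lemma measurable_Bmat {n d : ℕ} (ρ : ℝ) : Measurable (Bmat (n := n) (d := d) ρ) := by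
  refine measurable_pi_iff.2 fun i => measurable_pi_iff.2 fun j => ?_
  simp only [Bmat, Amat, sym]
  split_ifs <;> fun_prop

lemma measurable_Ymat {n d : ℕ} (η : ℝ) : Measurable (Ymat (n := n) (d := d) η) := by
  unfold Ymat
  fun_prop

lemma stdGaussPi_compl_goodGraphs_le (n : ℕ) :
    stdGaussPi (Fin n × Fin n) (goodGraphs n)ᶜ
      ≤ ENNReal.ofReal (4 * (exp ((n : ℝ) ^ 2 * exp (-(3 * log n))) - 1)) :=
  stdGaussPi_compl_goodArrays_le n _ _ edgeMap_injOn edgeMap_ne (Real.log_natCast_nonneg n)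
    (Real.log_le_self (Nat.cast_nonneg n)) fun φ => mod_cast card_movedEdges_le φ

lemma stdGaussPi_compl_goodFeatures_le (n d : ℕ) :
    stdGaussPi (Fin n × Fin d) (goodFeatures n d)ᶜ
      ≤ ENNReal.ofReal (4 * (exp ((n : ℝ) ^ 2 * exp (-(3 * log n))) - 1)) := by
  refine stdGaussPi_compl_goodArrays_le n _ _ (fun φ => ?_) (fun φ e he h => ?_)
    (Real.log_natCast_nonneg n) (le_max_right _ _) fun φ => ?_
  · rintro ⟨a, b⟩ _ ⟨c, e⟩ _ h
    simpa using h
  · simp only [Finset.mem_product, Equiv.Perm.mem_support] at he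
    exact he.1 (congrArg Prod.fst h)
  · rw [Finset.card_product, Finset.card_univ, Fintype.card_fin]
    push_cast
    gcongr
    exact le_max_left _ _

lemma tendsto_union_bound :
    Tendsto (fun n : ℕ => ENNReal.ofReal (4 * (exp ((n : ℝ) ^ 2 * exp (-(3 * log n))) - 1)))
      atTop (𝓝 0) := by
  have h : Tendsto (fun n : ℕ => 4 * (exp (1 / (n : ℝ)) - 1)) atTop (𝓝 0) := by
    have := (((Real.continuous_exp.tendsto 0).comp
      (tendsto_one_div_atTop_nhds_zero_nat (𝕜 := ℝ))).sub_const 1).const_mul 4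
    simpa using this
  have h2 := ENNReal.tendsto_ofReal h
  rw [ENNReal.ofReal_zero] at h2
  refine h2.congr' ?_
  filter_upwards [eventually_gt_atTop 0] with n hn
  have hn' : (0 : ℝ) < n := mod_cast hn
  congr 4
  rw [Real.exp_neg, show 3 * log (n : ℝ) = ((3 : ℕ) : ℝ) * log n by norm_num, Real.exp_nat_mul,
    Real.exp_log hn']
  field_simp

instance (n d : ℕ) : IsProbabilityMeasure (μ n d) := by
  unfold μ stdGaussG stdGaussF; infer_instance

/-- The event that both the weights `B` and the features `Y` are good. -/
def goodEvent (n d : ℕ) (ρ η : ℝ) : Set (Samp n d) :=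
  (fun ω : Samp n d => (Bmat ρ ω, Ymat η ω)) ⁻¹'
    (Prod.map Function.uncurry Function.uncurry ⁻¹' (goodGraphs n ×ˢ goodFeatures n d))

lemma measurableSet_good_pairs (n d : ℕ) :
    MeasurableSet ((Prod.map Function.uncurry Function.uncurry :
      GW n × FW n d → (Fin n × Fin n → ℝ) × (Fin n × Fin d → ℝ)) ⁻¹'
        (goodGraphs n ×ˢ goodFeatures n d)) :=
  ((measurableSet_goodArrays _ _ _ _ _).prod (measurableSet_goodArrays _ _ _ _ _)).preimage
    ((measurePreserving_uncurry (Fin n)).measurable.prodMap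
      (measurePreserving_uncurry (Fin d)).measurable)

lemma measure_compl_goodEvent_le (n d : ℕ) {ρ η : ℝ} (hρ : ρ ∈ Set.Icc (-1 : ℝ) 1)
    (hη : η ∈ Set.Icc (-1 : ℝ) 1) :
    μ n d (goodEvent n d ρ η)ᶜ
      ≤ ENNReal.ofReal (4 * (exp ((n : ℝ) ^ 2 * exp (-(3 * log n))) - 1))
        + ENNReal.ofReal (4 * (exp ((n : ℝ) ^ 2 * exp (-(3 * log n))) - 1)) := by
  have hsub : (goodEvent n d ρ η)ᶜ ⊆
      (fun ω : Samp n d => (rotatePair ρ (Prod.map Function.uncurry Function.uncurry ω.1)).1) ⁻¹'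
        (goodGraphs n)ᶜ ∪
      (fun ω : Samp n d => (rotatePair η (Prod.map Function.uncurry Function.uncurry ω.2)).1) ⁻¹'
        (goodFeatures n d)ᶜ := by
    intro ω hω
    by_contra hcon
    simp only [Set.mem_union, Set.mem_preimage, Set.mem_compl_iff, not_or, not_not] at hcon
    exact hω ⟨(uncurry_Bmat_mem_goodGraphs_iff ρ ω).2 hcon.1, hcon.2⟩
  refine (measure_mono hsub).trans ((measure_union_le _ _).trans (add_le_add ?_ ?_))
  · exact ((measurePreserving_fst.comp (measurePreserving_rotate_graph n d hρ)).measure_preimage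
      (s := (goodGraphs n)ᶜ) (measurableSet_goodArrays _ _ _ _ _).compl.nullMeasurableSet).trans_le
        (stdGaussPi_compl_goodGraphs_le n)
  · exact ((measurePreserving_fst.comp (measurePreserving_rotate_features n d hη)).measure_preimage
      (s := (goodFeatures n d)ᶜ) (measurableSet_goodArrays _ _ _ _ _).compl.nullMeasurableSet).trans_le
        (stdGaussPi_compl_goodFeatures_le n d)

end CGM

open CGM in
/-- **Laplace transform bounds for `V_G` and `V_F` (Lemma 3.3).**  There exist a universal
constant `C > 0` and events `H2 = H2(n)`, measurable with respect to `(B,Y)` alone and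
occurring with probability `1 − o(1)`, such that for all permutations `φ`:
`E[exp((ρ/(1−ρ²)) V_G(φ)) 1_{H2}] ≤ exp((ρ²/(2(1−ρ²)))(|D^E_φ| + C|D_φ| √(n log n)))` and
`E[exp((η/(1−η²)) V_F(φ)) 1_{H2}]
  ≤ exp((η²/(2(1−η²)))(d|D_φ| + C|D_φ| √(max{d, log n} log n)))`. -/
theorem laplace_bounds_VG_VF (d : ℕ → ℕ) (ρ η : ℕ → ℝ)
    (hρ : ∀ n, ρ n ∈ Set.Icc (-1 : ℝ) 1) (hη : ∀ n, η n ∈ Set.Icc (-1 : ℝ) 1) :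
    ∃ C > (0 : ℝ), ∃ H2 : (n : ℕ) → Set (Samp n (d n)),
      -- `H2` is measurable with respect to `(B, Y)` alone
      (∀ n : ℕ, ∃ S : Set (GW n × FW n (d n)), MeasurableSet S ∧
        H2 n = (fun ω : Samp n (d n) => (Bmat (ρ n) ω, Ymat (η n) ω)) ⁻¹' S) ∧
      -- `H2` occurs with probability `1 − o(1)`
      Tendsto (fun n => μ n (d n) (H2 n)) atTop (𝓝 1) ∧
      -- the Laplace transform bounds
      (∀ n : ℕ, ∀ φ : Equiv.Perm (Fin n),
        (∫ ω, Real.exp ((ρ n) / (1 - (ρ n) ^ 2) * VG (ρ n) φ ω) *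
            Set.indicator (H2 n) (fun _ => 1) ω ∂μ n (d n)) ≤
          Real.exp ((ρ n) ^ 2 / (2 * (1 - (ρ n) ^ 2)) *
            ((movedEdges φ).card + C * φ.support.card * Real.sqrt (n * Real.log n))) ∧
        (∫ ω, Real.exp ((η n) / (1 - (η n) ^ 2) * VF (η n) φ ω) *
            Set.indicator (H2 n) (fun _ => 1) ω ∂μ n (d n)) ≤
          Real.exp ((η n) ^ 2 / (2 * (1 - (η n) ^ 2)) *
            ((d n) * φ.support.card +
              C * φ.support.card *
                Real.sqrt (max (d n : ℝ) (Real.log n) * Real.log n)))) := by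
  have hsq : ∀ r : ℝ, r ∈ Set.Icc (-1 : ℝ) 1 → r ^ 2 ≤ 1 := fun r hr =>
    (sq_le_one_iff_abs_le_one r).2 (abs_le.2 hr)
  have hmeas : ∀ n, MeasurableSet (goodEvent n (d n) (ρ n) (η n)) := fun n =>
    (measurableSet_good_pairs n (d n)).preimage ((measurable_Bmat _).prodMk (measurable_Ymat _))
  refine ⟨91, by norm_num, fun n => goodEvent n (d n) (ρ n) (η n),
    fun n => ⟨_, measurableSet_good_pairs n (d n), rfl⟩, ?_, fun n φ => ⟨?_, ?_⟩⟩
  · have hlim := ENNReal.Tendsto.sub (tendsto_const_nhds (x := (1 : ENNReal)))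
      (tendsto_union_bound.add tendsto_union_bound) (Or.inl ENNReal.one_ne_top)
    rw [add_zero, tsub_zero] at hlim
    refine tendsto_of_tendsto_of_tendsto_of_le_of_le hlim tendsto_const_nhds (fun n => ?_)
      fun n => prob_le_one
    change _ ≤ μ n (d n) (goodEvent n (d n) (ρ n) (η n))
    rw [← compl_compl (goodEvent n (d n) (ρ n) (η n)), prob_compl_eq_one_sub (hmeas n).compl]
    exact tsub_le_tsub_left (measure_compl_goodEvent_le n (d n) (hρ n) (hη n)) 1
  · exact integral_exp_mul_indicator_le (measurePreserving_rotate_graph n (d n) (hρ n))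
      (movedEdges φ) (edgeMap φ) (hsq _ (hρ n)) (measurableSet_goodArrays n _ _ _ _)
      (fun x hx => hx φ) (fun ω hω => (uncurry_Bmat_mem_goodGraphs_iff _ ω).1 hω.1)
      (VG_eq (hsq _ (hρ n)) φ)
  · refine integral_exp_mul_indicator_le (measurePreserving_rotate_features n (d n) (hη n))
      (φ.support ×ˢ Finset.univ) (fun e => (φ e.1, e.2)) (hsq _ (hη n))
      (S := goodFeatures n (d n)) (measurableSet_goodArrays n _ _ _ _)
      (fun x hx => (hx φ).trans (le_of_eq ?_)) (fun ω hω => hω.2) (VF_eq (hsq _ (hη n)) φ)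
    rw [Finset.card_product, Finset.card_univ, Fintype.card_fin]
    push_cast
    ring
end
end
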